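/- arXiv:1611.01424 — 2 statements merged into one kernel-verified Lean document; each statement's English description precedes it below -/
import Mathlib

section
/- For every n ≥ 2 there exists an element w_n ∈ F_n such that: w_n is a C-test word with respect to every non-abelian free group; w_n is not a proper power; and for every free group F and all elements A_1, …, A_n ∈ F, one has w_n(A_1,…,A_n) = 1 if and only if the subgroup ⟨A_1,…,A_n⟩ of F generated by A_1, …, A_n is cyclic. -/
/-- `w` is a C-test word with respect to the free group `FreeGroup S`. -/
def IsCTestWord (n : ℕ) (w : FreeGroup (Fin n)) (S : Type*) : Prop :=
  w ≠ 1 ∧ ∀ A B : Fin n → FreeGroup S,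
    FreeGroup.lift A w = FreeGroup.lift B w → FreeGroup.lift A w ≠ 1 →
      ∃ s : FreeGroup S, ∀ i : Fin n, s * A i * s⁻¹ = B i

/-- An element of a group is a proper power if it is `v ^ k` for some `k ≥ 2`. -/
def IsProperPower {G : Type*} [Group G] (w : G) : Prop :=
  ∃ (v : G) (k : ℕ), 2 ≤ k ∧ w = v ^ k

namespace LeeWord

open FreeGroup

section

variable {S : Type*}

open Classical in
/-- The length of the longest common prefix of two lists. -/
noncomputable def prefixLength {α : Type*} : List α → List α → ℕ
  | a :: l, b :: m => if a = b then prefixLength l m + 1 else 0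
  | _, _ => 0

theorem prefixLength_spec {α : Type*} (l m : List α) :
    ∃ c a b : List α, l = c ++ a ∧ m = c ++ b ∧ c.length = prefixLength l m ∧
      ∀ x ∈ a.head?, ∀ y ∈ b.head?, x ≠ y := by
  induction l generalizing m with
  | nil => exact ⟨[], [], m, by simp, by simp, by simp [prefixLength], by simp⟩
  | cons x l ih =>
    cases m with
    | nil => exact ⟨[], x :: l, [], by simp, by simp, by simp [prefixLength], by simp⟩
    | cons y m =>
      by_cases h : x = y
      · obtain ⟨c, a, b, h1, h2, h3, h4⟩ := ih m
        refine ⟨x :: c, a, b, by simp [h1], by simp [h, h2], ?_, h4⟩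
        simp [prefixLength, h, h3]
      · refine ⟨[], x :: l, y :: m, by simp, by simp, by simp [prefixLength, h], ?_⟩
        simpa using h

theorem prefixLength_min_le {α : Type*} (l m k : List α) :
    min (prefixLength l m) (prefixLength m k) ≤ prefixLength l k := by
  induction l generalizing m k with
  | nil => simp [prefixLength]
  | cons x l ih =>
    cases m with
    | nil => simp [prefixLength]
    | cons y m =>
      cases k with
      | nil => simp [prefixLength]
      | cons z k =>
        have := ih m k
        simp only [prefixLength]
        split_ifs <;> first | omega | (exfalso; simp_all)

theorem prefixLength_comm {α : Type*} (l m : List α) : prefixLength l m = prefixLength m l := by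
  induction l generalizing m with
  | nil => cases m <;> simp [prefixLength]
  | cons x l ih =>
    cases m with
    | nil => simp [prefixLength]
    | cons y m =>
      by_cases h : x = y
      · simp [prefixLength, h, ih]
      · simp [prefixLength, h, Ne.symm h]

open Classical in
/-- The word metric on a free group, with values in the integers. -/
noncomputable def D (p q : FreeGroup S) : ℤ := ((p⁻¹ * q).norm : ℤ)

open Classical in
theorem norm_inv_mul_add (x y : FreeGroup S) :
    (x⁻¹ * y).norm + 2 * prefixLength x.toWord y.toWord = x.norm + y.norm := by
  obtain ⟨c, a, b, h1, h2, h3, h4⟩ := prefixLength_spec x.toWord y.toWord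
  have hx : IsReduced x.toWord := isReduced_toWord
  have hy : IsReduced y.toWord := isReduced_toWord
  have ha : IsReduced (invRev a) := by
    have : IsReduced a := by
      rw [h1] at hx; exact (List.isChain_append.1 hx).2.1
    rw [isReduced_iff_reduce_eq, reduce_invRev, this.reduce_eq]
  have hb : IsReduced b := by
    rw [h2] at hy; exact (List.isChain_append.1 hy).2.1
  have hab : IsReduced (invRev a ++ b) := by
    refine List.isChain_append.2 ⟨ha, hb, ?_⟩
    intro u hu v hv huv
    cases a with
    | nil => simp [invRev] at hu
    | cons g a =>
      have := h4 g (by simp) v hv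
      simp only [invRev, List.map_cons, List.reverse_cons, List.getLast?_append,
        List.getLast?_singleton, Option.some_or, Option.mem_some_iff] at hu
      subst hu
      simp only at huv ⊢
      have h5 : g.2 ≠ v.2 := fun h => this (Prod.ext huv h)
      cases hg : g.2 <;> cases hv2 : v.2 <;> simp_all
  have hxy : x⁻¹ * y = mk (invRev a ++ b) := by
    rw [← mk_toWord (x := x), ← mk_toWord (x := y), h1, h2, ← mul_mk, ← mul_mk, ← mul_mk, ← inv_mk]
    group
  have e1 : (x⁻¹ * y).norm = a.length + b.length := by
    rw [hxy, FreeGroup.norm, toWord_mk, hab.reduce_eq]; simp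
  have e2 : x.norm = c.length + a.length := by rw [FreeGroup.norm, h1]; simp
  have e3 : y.norm = c.length + b.length := by rw [FreeGroup.norm, h2]; simp
  omega

theorem D_nonneg (p q : FreeGroup S) : 0 ≤ D p q := by unfold D; positivity

theorem D_self (p : FreeGroup S) : D p p = 0 := by simp [D]

theorem D_eq_zero {p q : FreeGroup S} (h : D p q = 0) : p = q := by
  classical
  have : (p⁻¹ * q).norm = 0 := by unfold D at h; exact_mod_cast h
  rw [FreeGroup.norm_eq_zero] at this
  exact (inv_mul_eq_one.1 this)

theorem D_comm (p q : FreeGroup S) : D p q = D q p := by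
  classical
  unfold D
  rw [← FreeGroup.norm_inv_eq (x := p⁻¹ * q)]
  simp

theorem D_mul_left (g p q : FreeGroup S) : D (g * p) (g * q) = D p q := by
  unfold D
  congr 2
  group

theorem D_triangle (p q r : FreeGroup S) : D p r ≤ D p q + D q r := by
  classical
  unfold D
  have : p⁻¹ * r = (p⁻¹ * q) * (q⁻¹ * r) := by group
  rw [this]
  exact_mod_cast FreeGroup.norm_mul_le _ _

/-- The four-point condition for the word metric of a free group. -/
theorem D_four (a b c e : FreeGroup S) : D a b + D c e ≤ max (D a c + D b e) (D a e + D b c) := by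
  classical
  have key : ∀ p q, D p q = D a p + D a q
      - 2 * (prefixLength (a⁻¹ * p).toWord (a⁻¹ * q).toWord : ℤ) := by
    intro p q
    have := norm_inv_mul_add (a⁻¹ * p) (a⁻¹ * q)
    have h : (a⁻¹ * p)⁻¹ * (a⁻¹ * q) = p⁻¹ * q := by group
    rw [h] at this
    unfold D
    zify at this
    linarith
  have h1 := key c e
  have h2 := key b e
  have h3 := key b c
  have h4 := prefixLength_min_le (a⁻¹ * c).toWord (a⁻¹ * b).toWord (a⁻¹ * e).toWord
  rw [prefixLength_comm (a⁻¹ * c).toWord (a⁻¹ * b).toWord] at h4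
  omega

theorem exists_between (p q : FreeGroup S) {k : ℤ} (h0 : 0 ≤ k) (hk : k ≤ D p q) :
    ∃ m, D p m = k ∧ D m q = D p q - k := by
  classical
  set w := p⁻¹ * q with hw
  have hred : IsReduced w.toWord := isReduced_toWord
  obtain ⟨n, rfl⟩ := Int.eq_ofNat_of_zero_le h0
  have hlen : D p q = w.toWord.length := rfl
  have hn : n ≤ w.toWord.length := by
    rw [hlen] at hk; exact_mod_cast hk
  have hsplit : w.toWord.take n ++ w.toWord.drop n = w.toWord := List.take_append_drop _ _
  rw [← hsplit] at hred
  obtain ⟨r1, r2, -⟩ := List.isChain_append.1 hred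
  refine ⟨p * mk (w.toWord.take n), ?_, ?_⟩
  · unfold D
    rw [show p⁻¹ * (p * mk (w.toWord.take n)) = mk (w.toWord.take n) by group, FreeGroup.norm, toWord_mk,
      IsReduced.reduce_eq r1]
    simp [hn]
  · have hq : q = p * w := by rw [hw]; group
    have : (p * mk (w.toWord.take n))⁻¹ * q = mk (w.toWord.drop n) := by
      have h2 : w = mk (w.toWord.take n) * mk (w.toWord.drop n) := by
        rw [mul_mk, hsplit, mk_toWord]
      rw [hq]
      calc _ = (mk (w.toWord.take n))⁻¹ * w := by group
        _ = _ := by nth_rewrite 2 [h2]; group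
    rw [hlen]
    unfold D
    rw [this, FreeGroup.norm, toWord_mk, IsReduced.reduce_eq r2]
    simp [hn]

open Classical in
/-- The translation length of an element of a free group. -/
noncomputable def τ (g : FreeGroup S) : ℤ := ((FreeGroup.reduceCyclically g.toWord).length : ℤ)

open Classical in
theorem D_one_pow (g : FreeGroup S) (n : ℕ) :
    D 1 (g ^ (n + 1)) = τ g * (n + 1) + 2 * ((reduceCyclically.conjugator g.toWord).length : ℤ) := by
  unfold D τ
  rw [FreeGroup.norm, inv_one, one_mul, toWord_pow,
    reduceCyclically.reduce_flatten_replicate_succ isReduced_toWord]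
  simp [invRev_length]
  ring

open Classical in
theorem exists_axis_one (g : FreeGroup S) :
    ∃ p', D p' (g * p') = τ g ∧ 2 * D 1 p' = D 1 g - τ g := by
  have hg := reduceCyclically.conj_conjugator_reduceCyclically g.toWord
  set c := reduceCyclically.conjugator g.toWord with hc
  set k := FreeGroup.reduceCyclically g.toWord with hk
  have hred : IsReduced g.toWord := isReduced_toWord
  have hred2 : IsReduced k := (reduceCyclically.isCyclicallyReduced hred).isReduced
  have hredc : IsReduced c := by
    rw [← hg, List.append_assoc] at hred
    exact (List.isChain_append.1 hred).1
  have hgm : g = mk c * mk k * (mk c)⁻¹ := by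
    rw [inv_mk, mul_mk, mul_mk, hg, mk_toWord]
  refine ⟨mk c, ?_, ?_⟩
  · unfold D τ
    have : (mk c)⁻¹ * (g * mk c) = mk k := by
      rw [hgm]; group
    rw [this, FreeGroup.norm, toWord_mk, hred2.reduce_eq]
  · have h := D_one_pow g 0
    simp only [zero_add, pow_one, ← hc] at h
    have : D 1 (mk c) = c.length := by
      unfold D
      rw [inv_one, one_mul, FreeGroup.norm, toWord_mk, hredc.reduce_eq]
    rw [this]
    push_cast at h
    linarith

theorem D_conj (p g : FreeGroup S) : D p (g * p) = D 1 (p⁻¹ * g * p) := by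
  unfold D
  congr 2
  group

theorem τ_nonneg (g : FreeGroup S) : 0 ≤ τ g := by unfold τ; positivity

open Classical in
theorem τ_le_D_one (g : FreeGroup S) : τ g ≤ D 1 g := by
  have h1 := D_one_pow g 0
  norm_num at h1
  have := τ_nonneg g
  linarith [Int.natCast_nonneg (reduceCyclically.conjugator g.toWord).length]

theorem D_inv_left (g p q : FreeGroup S) : D (g⁻¹ * p) q = D p (g * q) := by
  rw [← D_mul_left g, mul_inv_cancel_left]

theorem D_inv_right (g p q : FreeGroup S) : D p (g⁻¹ * q) = D (g * p) q := by
  rw [D_comm, D_inv_left, D_comm]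

theorem D_inv_self (g p : FreeGroup S) : D p (g⁻¹ * p) = D p (g * p) := by
  rw [D_inv_right, D_comm]

theorem τ_conj (p g : FreeGroup S) : τ (p * g * p⁻¹) = τ g := by
  have key : ∀ h q : FreeGroup S, ∃ C : ℤ, ∀ n : ℕ,
      τ h * (n + 1) - τ (q * h * q⁻¹) * (n + 1) ≤ C := by
    classical
    intro h q
    refine ⟨2 * D 1 q + 2 * ((reduceCyclically.conjugator (q * h * q⁻¹).toWord).length : ℤ), ?_⟩
    intro n
    have e1 := D_one_pow h n
    have e2 := D_one_pow (q * h * q⁻¹) n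
    rw [conj_pow] at e2
    have h1 := D_triangle q 1 (q * h ^ (n + 1))
    have h2 := D_triangle 1 (q * h ^ (n + 1) * q⁻¹) (q * h ^ (n + 1))
    have h3 := D_mul_left q 1 (h ^ (n + 1))
    have h4 := D_mul_left (q * h ^ (n + 1)) q⁻¹ 1
    have h5 := D_mul_left q q⁻¹ 1
    rw [mul_one] at h3 h4 h5
    rw [mul_inv_cancel] at h5
    rw [D_comm q 1] at h1
    have : (0 : ℤ) ≤ ((reduceCyclically.conjugator h.toWord).length : ℤ) := by positivity
    linarith
  have key2 : ∀ h q : FreeGroup S, τ h ≤ τ (q * h * q⁻¹) := by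
    intro h q
    obtain ⟨C, hC⟩ := key h q
    by_contra! hlt
    have h1 := hC C.toNat
    have h2 := Int.self_le_toNat C
    have h3 : (0 : ℤ) ≤ C.toNat := by positivity
    nlinarith
  refine le_antisymm ?_ (key2 g p)
  have := key2 (p * g * p⁻¹) p⁻¹
  rwa [show p⁻¹ * (p * g * p⁻¹) * p⁻¹⁻¹ = g by group] at this

theorem τ_conj' (p g : FreeGroup S) : τ (p⁻¹ * g * p) = τ g := by
  have := τ_conj p⁻¹ g
  rwa [inv_inv] at this

theorem D_conj_pow (p g : FreeGroup S) (n : ℕ) :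
    D p (g ^ n * p) = D 1 ((p⁻¹ * g * p) ^ n) := by
  have : (p⁻¹ * g * p) ^ n = p⁻¹ * g ^ n * p := by
    have := conj_pow (i := n) (a := p⁻¹) (b := g)
    rwa [inv_inv] at this
  rw [D_conj, this]

theorem D_pow_succ (p g : FreeGroup S) (n : ℕ) :
    D p (g ^ (n + 1) * p) = D p (g * p) + n * τ g := by
  have h1 := D_conj_pow p g (n + 1)
  have h2 := D_conj_pow p g 1
  rw [D_one_pow, τ_conj'] at h1
  have h3 := D_one_pow (p⁻¹ * g * p) 0
  rw [τ_conj', zero_add, ← h2, pow_one] at h3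
  push_cast at h3
  linarith

theorem τ_eq (p g : FreeGroup S) : τ g = D p (g * (g * p)) - D p (g * p) := by
  have := D_pow_succ p g 1
  rw [← mul_assoc, ← sq]
  push_cast at this
  linarith

theorem τ_le (p g : FreeGroup S) : τ g ≤ D p (g * p) := by
  rw [D_conj, ← τ_conj' p g]
  exact τ_le_D_one _

theorem exists_axis (p g : FreeGroup S) :
    ∃ p', D p' (g * p') = τ g ∧ 2 * D p p' = D p (g * p) - τ g := by
  obtain ⟨c, h1, h2⟩ := exists_axis_one (p⁻¹ * g * p)
  rw [τ_conj'] at h1 h2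
  refine ⟨p * c, ?_, ?_⟩
  · rw [← h1, D_conj, D_conj]
    congr 1; group
  · rw [D_conj p g, ← h2, ← D_mul_left p 1 c, mul_one]

theorem D_pow_axis {p g : FreeGroup S} (h : D p (g * p) = τ g) (n : ℕ) :
    D p (g ^ n * p) = n * τ g := by
  cases n with
  | zero => simp [D_self]
  | succ n => rw [D_pow_succ, h]; push_cast; ring

theorem D_zpow_axis {p g : FreeGroup S} (h : D p (g * p) = τ g) (n : ℤ) :
    D p (g ^ n * p) = |n| * τ g := by
  obtain ⟨m, rfl | rfl⟩ := n.eq_nat_or_neg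
  · rw [zpow_natCast, D_pow_axis h]; simp
  · rw [zpow_neg, zpow_natCast, D_inv_self, D_pow_axis h]; simp

theorem D_zpow_axis' {p g : FreeGroup S} (h : D p (g * p) = τ g) (n m : ℤ) :
    D (g ^ n * p) (g ^ m * p) = |m - n| * τ g := by
  rw [← D_zpow_axis h, ← D_mul_left (g ^ n) p]
  congr 1
  rw [← mul_assoc, ← zpow_add]
  congr 2; ring

theorem τ_eq_zero {g : FreeGroup S} (h : τ g = 0) : g = 1 := by
  obtain ⟨p, hp, -⟩ := exists_axis 1 g
  rw [h] at hp
  have := D_eq_zero hp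
  exact (mul_eq_right.1 this.symm)

theorem τ_pos {g : FreeGroup S} (h : g ≠ 1) : 1 ≤ τ g := by
  have := τ_nonneg g
  have h2 : τ g ≠ 0 := fun h' => h (τ_eq_zero h')
  omega

theorem τ_one : τ (1 : FreeGroup S) = 0 := by
  have := τ_le 1 (1 : FreeGroup S)
  have h2 := τ_nonneg (1 : FreeGroup S)
  rw [mul_one, D_self] at this
  omega

theorem τ_pow (g : FreeGroup S) (n : ℕ) : τ (g ^ n) = n * τ g := by
  cases n with
  | zero => simp [τ_one]
  | succ n =>
    obtain ⟨p, hp, -⟩ := exists_axis 1 g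
    rw [τ_eq p, ← mul_assoc, ← pow_add, D_pow_axis hp, D_pow_axis hp]
    push_cast; ring

theorem τ_inv (g : FreeGroup S) : τ g⁻¹ = τ g := by
  obtain ⟨p, hp, -⟩ := exists_axis 1 g
  rw [τ_eq p, ← mul_assoc, ← mul_inv_rev, ← sq, D_inv_self, D_inv_self, D_pow_axis hp, hp]
  push_cast; ring

theorem τ_zpow (g : FreeGroup S) (n : ℤ) : τ (g ^ n) = |n| * τ g := by
  obtain ⟨m, rfl | rfl⟩ := n.eq_nat_or_neg
  · rw [zpow_natCast, τ_pow]; simp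
  · rw [zpow_neg, zpow_natCast, τ_inv, τ_pow]; simp

theorem axis_translate {p g : FreeGroup S} (h : D p (g * p) = τ g) (n : ℤ) :
    D (g ^ n * p) (g * (g ^ n * p)) = τ g := by
  rw [← mul_assoc, ← zpow_one_add, D_zpow_axis' h]
  simp

theorem axis_conj {p g : FreeGroup S} (h : D p (g * p) = τ g) (k : FreeGroup S) :
    D (k * p) (k * g * k⁻¹ * (k * p)) = τ (k * g * k⁻¹) := by
  rw [τ_conj, ← h, ← D_mul_left k p]
  congr 1; group

/-- Twice the Gromov product of `p` and `q` based at `r`. -/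
noncomputable def gp (r p q : FreeGroup S) : ℤ := D r p + D r q - D p q

theorem gp_comm (r p q : FreeGroup S) : gp r p q = gp r q p := by
  unfold gp; rw [D_comm p q]; ring

theorem gp_min (r p q s : FreeGroup S) : min (gp r p s) (gp r s q) ≤ gp r p q := by
  unfold gp
  have h1 := D_four p q s r
  have h2 := D_comm p r
  have h3 := D_comm q r
  have h4 := D_comm s q
  have h5 := D_comm s r
  omega

theorem gp_le_left (r p q : FreeGroup S) : gp r p q ≤ 2 * D r p := by
  unfold gp
  have := D_triangle r p q
  omega

theorem gp_le_right (r p q : FreeGroup S) : gp r p q ≤ 2 * D r q := by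
  rw [gp_comm]; exact gp_le_left r q p

theorem gp_nonneg (r p q : FreeGroup S) : 0 ≤ gp r p q := by
  unfold gp
  have := D_triangle p r q
  have := D_comm p r
  omega

/-- Two points on a geodesic are at distance the difference of their parameters. -/
theorem D_of_mem {a b x y : FreeGroup S} (hx : D a x + D x b = D a b)
    (hy : D a y + D y b = D a b) : D x y = |D a x - D a y| := by
  have h1 := D_four a b x y
  have h2 := D_comm x b
  have h3 := D_comm y b
  have h4 := D_triangle a x y
  have h5 := D_triangle a y x
  have h6 := D_comm x y
  rcases abs_cases (D a x - D a y) with h | h <;> omega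

theorem eq_of_mem {a b x y : FreeGroup S} (hx : D a x + D x b = D a b)
    (hy : D a y + D y b = D a b) (h : D a x = D a y) : x = y := by
  apply D_eq_zero
  rw [D_of_mem hx hy, h]; simp

/-- The displacement function of an isometry is convex. -/
theorem D_convex {p q e : FreeGroup S} (u : FreeGroup S) (he : D p e + D e q = D p q) :
    D e (u * e) ≤ max (D p (u * p)) (D q (u * q)) := by
  have h1 := D_four e (u * e) p q
  have a2 := D_mul_left u p e
  have a3 := D_mul_left u q e
  have t1 := D_triangle p (u * p) (u * e)
  have t2 := D_triangle q (u * q) (u * e)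
  have c1 := D_comm (u * e) p
  have c2 := D_comm (u * e) q
  have c3 := D_comm e p
  have c4 := D_comm e q
  omega

theorem commute_of_zpow {x y : FreeGroup S} {n : ℤ} (hn : n ≠ 0) (h : Commute x (y ^ n)) :
    Commute x y := by
  have h1 : (x * y * x⁻¹) ^ n = y ^ n := by
    rw [conj_zpow, h.eq, mul_inv_cancel_right]
  have h2 : x * y * x⁻¹ = y := zpow_left_injective hn h1
  exact mul_inv_eq_iff_eq_mul.1 h2

theorem exists_zpowers_of_commute (H : Subgroup (FreeGroup S))
    (hH : ∀ a ∈ H, ∀ b ∈ H, Commute a b) : ∃ g, H = Subgroup.zpowers g := by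
  have e := IsFreeGroup.toFreeGroup H
  have hsub : ∀ a b : IsFreeGroup.Generators H, a = b := by
    intro a b
    by_contra hne
    have h1 : Commute (FreeGroup.of a) (FreeGroup.of b) := by
      have h2 := hH _ (e.symm (of a)).2 _ (e.symm (of b)).2
      have h3 : e.symm (of a) * e.symm (of b) = e.symm (of b) * e.symm (of a) :=
        Subtype.ext h2.eq
      rw [← _root_.map_mul, ← _root_.map_mul] at h3
      exact e.symm.injective h3
    classical
    have h4 := congrArg FreeGroup.toWord h1.eq
    rw [toWord_mul, toWord_mul] at h4
    simp [toWord_of, FreeGroup.reduce, hne, Ne.symm hne] at h4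
  have hcyc : ∃ x : FreeGroup (IsFreeGroup.Generators H), ∀ y, y ∈ Subgroup.zpowers x := by
    by_cases hemp : Nonempty (IsFreeGroup.Generators H)
    · obtain ⟨a⟩ := hemp
      refine ⟨of a, fun y => ?_⟩
      induction y using FreeGroup.induction_on with
      | C1 => exact one_mem _
      | of b => rw [hsub b a]; exact Subgroup.mem_zpowers _
      | inv_of b hb => exact inv_mem hb
      | mul x y hx hy => exact mul_mem hx hy
    · rw [not_nonempty_iff] at hemp
      refine ⟨1, fun y => ?_⟩
      rw [Subsingleton.elim y 1]; exact one_mem _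
  obtain ⟨x, hx⟩ := hcyc
  refine ⟨(e.symm x : H), ?_⟩
  ext y
  constructor
  · intro hy
    obtain ⟨k, hk⟩ := Subgroup.mem_zpowers_iff.1 (hx (e ⟨y, hy⟩))
    refine Subgroup.mem_zpowers_iff.2 ⟨k, ?_⟩
    have : e.symm x ^ k = ⟨y, hy⟩ := by rw [← map_zpow, hk, MulEquiv.symm_apply_apply]
    rw [← Subgroup.coe_zpow, this]
  · intro hy
    obtain ⟨k, rfl⟩ := Subgroup.mem_zpowers_iff.1 hy
    exact zpow_mem (e.symm x).2 k

theorem exists_zpowers_closure {ι : Type*} (A : ι → FreeGroup S)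
    (hA : ∀ i j, Commute (A i) (A j)) :
    ∃ g, Subgroup.closure (Set.range A) = Subgroup.zpowers g := by
  refine exists_zpowers_of_commute _ ?_
  have hcomm := Subgroup.isMulCommutative_closure (k := Set.range A) (by
    rintro _ ⟨i, rfl⟩ _ ⟨j, rfl⟩
    exact hA i j)
  intro a ha b hb
  have := mul_comm' (⟨a, ha⟩ : Subgroup.closure (Set.range A)) ⟨b, hb⟩
  exact congrArg Subtype.val this

theorem exists_root {u v : FreeGroup S} (h : Commute u v) :
    ∃ (r : FreeGroup S) (a b : ℤ), u = r ^ a ∧ v = r ^ b := by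
  obtain ⟨g, hg⟩ := exists_zpowers_closure (fun i : Bool => if i then u else v) (by
    intro i j
    cases i <;> cases j <;> simp [h, h.symm])
  have hu : u ∈ Subgroup.zpowers g := by
    rw [← hg]; exact Subgroup.subset_closure ⟨true, by simp⟩
  have hv : v ∈ Subgroup.zpowers g := by
    rw [← hg]; exact Subgroup.subset_closure ⟨false, by simp⟩
  obtain ⟨a, ha⟩ := Subgroup.mem_zpowers_iff.1 hu
  obtain ⟨b, hb⟩ := Subgroup.mem_zpowers_iff.1 hv
  exact ⟨g, a, b, ha.symm, hb.symm⟩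

theorem commute_trans {a u b : FreeGroup S} (hu : u ≠ 1) (h1 : Commute a u) (h2 : Commute u b) :
    Commute a b := by
  obtain ⟨r, k, l, rfl, rfl⟩ := exists_root h1
  have hl : l ≠ 0 := by rintro rfl; simp at hu
  exact ((commute_of_zpow hl h2.symm).zpow_right k).symm

theorem conj_ne_inv {u R : FreeGroup S} (hu : u ≠ 1) : R * u * R⁻¹ ≠ u⁻¹ := by
  intro h
  have h1 : Commute u (R ^ (2 : ℤ)) := by
    have h2 : R ^ 2 * u * (R ^ 2)⁻¹ = u := by
      calc _ = R * (R * u * R⁻¹) * R⁻¹ := by simp only [sq, mul_inv_rev, mul_assoc]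
        _ = (R * u * R⁻¹)⁻¹ := by nth_rewrite 1 [h]; simp only [mul_inv_rev, inv_inv, mul_assoc]
        _ = u := by rw [h, inv_inv]
    have h3 := mul_inv_eq_iff_eq_mul.1 h2
    have : R ^ (2 : ℤ) = R ^ 2 := by norm_cast
    rw [this]
    exact h3.symm
  have h2 := commute_of_zpow two_ne_zero h1
  rw [← h2.eq, mul_inv_cancel_right] at h
  have h3 : u ^ 2 = 1 := by rw [sq]; nth_rewrite 2 [h]; exact mul_inv_cancel u
  exact hu ((pow_eq_one_iff_left two_ne_zero).1 h3)

theorem commute_of_conj {u R : FreeGroup S} (hu : u ≠ 1) (h : Commute (R * u * R⁻¹) u) :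
    Commute R u := by
  obtain ⟨r, a, b, h1, h2⟩ := exists_root h
  have hr : τ r ≠ 0 := by
    intro h0
    rw [τ_eq_zero h0, one_zpow] at h2
    exact hu h2
  have h3 := τ_conj R u
  rw [h1, h2, τ_zpow, τ_zpow] at h3
  have h4 : |a| = |b| := mul_right_cancel₀ hr h3
  rcases abs_eq_abs.1 h4 with h5 | h5
  · rw [h5, ← h2] at h1
    exact mul_inv_eq_iff_eq_mul.1 h1
  · rw [h5, zpow_neg, ← h2] at h1
    exact absurd h1 (conj_ne_inv hu)

theorem exists_zpow_of_commute {u x : FreeGroup S} (hu : u ≠ 1) (hp : ¬ IsProperPower u)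
    (h : Commute x u) : ∃ j : ℤ, x = u ^ j := by
  obtain ⟨r, a, b, hx, h2⟩ := exists_root h
  have hb : b = 1 ∨ b = -1 := by
    have h0 : b ≠ 0 := by rintro rfl; simp [h2] at hu
    by_contra hcon
    push Not at hcon
    refine hp ?_
    obtain ⟨m, rfl | rfl⟩ := b.eq_nat_or_neg
    · exact ⟨r, m, by omega, by simpa using h2⟩
    · exact ⟨r⁻¹, m, by omega, by simpa using h2⟩
  rcases hb with rfl | rfl
  · exact ⟨a, by rw [hx, h2, zpow_one]⟩
  · exact ⟨-a, by rw [hx, h2, ← zpow_mul]; simp⟩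

theorem zpow_eq_zero {u : FreeGroup S} (hu : u ≠ 1) {n : ℤ} (h : u ^ n = 1) : n = 0 := by
  have h1 := τ_zpow u n
  rw [h, τ_one] at h1
  have h2 := τ_pos hu
  rcases mul_eq_zero.1 h1.symm with h3 | h3
  · exact abs_eq_zero.1 h3
  · omega

theorem zpow_inj {u : FreeGroup S} (hu : u ≠ 1) {n m : ℤ} (h : u ^ n = u ^ m) : n = m := by
  have : u ^ (n - m) = 1 := by rw [zpow_sub, h, mul_inv_cancel]
  have := zpow_eq_zero hu this
  omega

theorem conj_zpow_eq_zero {t u : FreeGroup S} (h : ¬ Commute t u) {a b : ℤ}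
    (hab : t⁻¹ * u ^ a * t = u ^ b) : a = 0 := by
  by_contra ha
  have hu : u ≠ 1 := by rintro rfl; exact h (Commute.one_right t)
  have h1 : u ^ a ≠ 1 := fun h' => ha (zpow_eq_zero hu h')
  have h2 : Commute (t⁻¹ * u ^ a * t⁻¹⁻¹) (u ^ a) := by
    rw [inv_inv, hab]
    exact (Commute.refl u).zpow_zpow b a
  have h3 := commute_of_zpow ha (commute_of_conj h1 h2)
  exact h (Commute.inv_left_iff.1 h3)

theorem D_displace (x y g : FreeGroup S) : D x (g * x) ≤ D y (g * y) + 2 * D x y := by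
  have h1 := D_triangle x y (g * x)
  have h2 := D_triangle y (g * y) (g * x)
  have h3 := D_mul_left g y x
  have h4 := D_comm x y
  omega

theorem D_mul_mul_le (p g h : FreeGroup S) : D p (g * h * p) ≤ D p (g * p) + D p (h * p) := by
  have h1 := D_triangle p (g * p) (g * h * p)
  rw [mul_assoc g h p, D_mul_left] at h1
  rwa [mul_assoc]

theorem shift_mem {u p q m : FreeGroup S} {R : ℤ} (hp : D p (u * p) ≤ R) (hq : D q (u * q) ≤ R)
    (hm : D p m + D m q = D p q) (h1 : R < D p m) (h2 : R < D m q) :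
    D p (u * m) + D (u * m) q = D p q ∧ D p (u * m) = D p m + (D p (u * q) - D p q) := by
  have f1 := D_four p (u * m) (u * p) (u * q)
  have f2 := D_four q (u * m) (u * q) (u * p)
  have f3 := D_four p (u * q) (u * p) q
  have i1 := D_mul_left u p q
  have i2 := D_mul_left u m q
  have i3 := D_mul_left u m p
  have t1 := D_triangle p (u * m) (u * q)
  have t2 := D_triangle q (u * m) (u * p)
  have t3 := D_triangle p (u * m) q
  have c1 := D_comm (u * p) (u * q)
  have c2 := D_comm m p
  have c3 := D_comm q (u * m)
  have c4 := D_comm q (u * p)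
  have c5 := D_comm q (u * q)
  have n1 := D_nonneg p (u * m)
  have n2 := D_nonneg (u * m) q
  have n3 := D_nonneg p (u * p)
  omega

/-- Two elements moving the endpoints of a long segment by little commute. -/
theorem commute_of_displace {u v p q : FreeGroup S} {R : ℤ} (hup : D p (u * p) ≤ R)
    (huq : D q (u * q) ≤ R) (hvp : D p (v * p) ≤ R) (hvq : D q (v * q) ≤ R)
    (h : 4 * R + 2 ≤ D p q) : Commute u v := by
  have hR : 0 ≤ R := le_trans (D_nonneg _ _) hup
  obtain ⟨m, hm1, hm2⟩ := exists_between p q (k := 2 * R + 1) (by omega) (by omega)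
  have key : ∀ w : FreeGroup S, D p (w * p) ≤ R → D q (w * q) ≤ R →
      |D p (w * q) - D p q| ≤ R := by
    intro w _ hq
    have h1 := D_triangle p q (w * q)
    have h2 := D_triangle p (w * q) q
    have h3 := D_comm q (w * q)
    rw [abs_le]
    omega
  have ku := abs_le.1 (key u hup huq)
  have kv := abs_le.1 (key v hvp hvq)
  obtain ⟨a1, a2⟩ := shift_mem hup huq (m := m) (by omega) (by omega) (by omega)
  obtain ⟨b1, b2⟩ := shift_mem hvp hvq (m := m) (by omega) (by omega) (by omega)
  obtain ⟨c1, c2⟩ := shift_mem hvp hvq (m := u * m) (by omega) (by omega) (by omega)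
  obtain ⟨d1, d2⟩ := shift_mem hup huq (m := v * m) (by omega) (by omega) (by omega)
  have := eq_of_mem d1 c1 (by omega)
  rw [← mul_assoc, ← mul_assoc] at this
  exact mul_right_cancel this

theorem commute_of_fellow {u h a b a' b' : FreeGroup S} {l ρ : ℤ} (hu : u ≠ 1)
    (ha : D a (u * a) ≤ l) (hb : D b (u * b) ≤ l) (ha' : D a' (u * a') ≤ l)
    (hb' : D b' (u * b') ≤ l) (haa : D a (h * a') ≤ ρ) (hbb : D b (h * b') ≤ ρ)
    (hab : 4 * (2 * ρ + l) + 2 ≤ D a b) : Commute h u := by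
  have hρ : 0 ≤ ρ := le_trans (D_nonneg _ _) haa
  have key : ∀ x x' : FreeGroup S, D x' (u * x') ≤ l → D x (h * x') ≤ ρ →
      D x (h * u * h⁻¹ * x) ≤ 2 * ρ + l := by
    intro x x' hx hxx
    have h1 := D_displace x (h * x') (h * u * h⁻¹)
    have h2 := D_mul_left h x' (u * x')
    rw [show h * u * h⁻¹ * (h * x') = h * (u * x') by group] at h1
    omega
  exact commute_of_conj hu
    (commute_of_displace (key a a' ha' haa) (key b b' hb' hbb) (by omega) (by omega) hab)

theorem gp_backtrack {u R p : FreeGroup S} {K : ℤ} (hu : u ≠ 1) (hp : D p (u * p) = τ u)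
    (hK : 0 ≤ K) (hR : D p (R * p) ≤ K * τ u) (a b : ℕ) :
    gp p ((u ^ a)⁻¹ * p) (R * (u ^ b * p)) ≤ (50 * K + 12) * τ u := by
  have hl := τ_pos hu
  have hKl : 0 ≤ K * τ u := by positivity
  have ea : D p ((u ^ a)⁻¹ * p) = a * τ u := by rw [D_inv_self, D_pow_axis hp]
  have eb : D (R * p) (R * (u ^ b * p)) = b * τ u := by rw [D_mul_left, D_pow_axis hp]
  have hY := D_triangle p (R * p) (R * (u ^ b * p))
  have hY2 := D_triangle (R * p) p (R * (u ^ b * p))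
  have cR := D_comm (R * p) p
  by_cases hcomm : Commute R u
  · have e1 : R * (u ^ b * p) = u ^ b * (R * p) := by
      rw [← mul_assoc, (hcomm.pow_right b).eq, mul_assoc]
    have t1 := D_triangle ((u ^ a)⁻¹ * p) (u ^ b * (R * p)) (u ^ b * p)
    have t2 : D ((u ^ a)⁻¹ * p) (u ^ b * p) = (a + b) * τ u := by
      rw [D_inv_left, ← mul_assoc, ← pow_add, D_pow_axis hp]; push_cast; ring
    have t3 := D_mul_left (u ^ b) (R * p) p
    unfold gp
    rw [e1] at eb hY ⊢
    linarith
  · by_contra! hgp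
    have g1 := gp_le_left p ((u ^ a)⁻¹ * p) (R * (u ^ b * p))
    have g2 := gp_le_right p ((u ^ a)⁻¹ * p) (R * (u ^ b * p))
    have hka : 24 * K + 6 ≤ a := by
      by_contra! hlt
      have : (a : ℤ) * τ u ≤ (24 * K + 6) * τ u := by gcongr
      linarith
    have hkb : 24 * K + 6 ≤ b := by
      by_contra! hlt
      have : (b : ℤ) * τ u ≤ (24 * K + 6) * τ u := by gcongr
      linarith
    obtain ⟨k, hk⟩ := Int.eq_ofNat_of_zero_le (show 0 ≤ 24 * K + 6 by omega)
    have hka' : k ≤ a := by rw [hk] at hka; exact_mod_cast hka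
    have hkb' : k ≤ b := by rw [hk] at hkb; exact_mod_cast hkb
    set X := (u ^ a)⁻¹ * p with hX
    set Y := R * (u ^ b * p) with hYd
    have e1 : D p ((u ^ k)⁻¹ * p) = k * τ u := by rw [D_inv_self, D_pow_axis hp]
    have e2 : D ((u ^ k)⁻¹ * p) X = (a - k) * τ u := by
      have := D_zpow_axis' hp (-k) (-a)
      rw [zpow_neg, zpow_neg, zpow_natCast, zpow_natCast] at this
      rw [hX, this, abs_of_nonpos (by omega)]
      ring
    have e3 : D (R * p) (R * (u ^ k * p)) = k * τ u := by rw [D_mul_left, D_pow_axis hp]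
    have e4 : D (R * (u ^ k * p)) Y = (b - k) * τ u := by
      have := D_zpow_axis' hp k b
      rw [zpow_natCast, zpow_natCast] at this
      rw [hYd, D_mul_left, this, abs_of_nonneg (by omega)]
    have t1 := D_triangle p (R * p) (R * (u ^ k * p))
    have t2 := D_triangle (R * p) p (R * (u ^ k * p))
    have m1 := gp_min p ((u ^ k)⁻¹ * p) Y X
    have m2 := gp_min p ((u ^ k)⁻¹ * p) (R * (u ^ k * p)) Y
    have hkl : (k : ℤ) * τ u = 24 * (K * τ u) + 6 * τ u := by rw [← hk]; ring
    have hd : D ((u ^ k)⁻¹ * p) (R * (u ^ k * p)) ≤ 3 * (K * τ u) := by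
      have cY := gp_comm p (R * (u ^ k * p)) Y
      unfold gp at *
      have r1 : ((a : ℤ) - k) * τ u = a * τ u - k * τ u := by ring
      have r2 : ((b : ℤ) - k) * τ u = b * τ u - k * τ u := by ring
      have r3 : (50 * K + 12) * τ u = 50 * (K * τ u) + 12 * τ u := by ring
      rw [r1] at e2
      rw [r2] at e4
      rw [r3] at hgp
      have cX := D_comm Y (R * (u ^ k * p))
      omega
    refine hcomm (commute_of_fellow (a := p) (a' := p) (b := (u ^ k)⁻¹ * p) (b' := u ^ k * p)
      (l := τ u) (ρ := 3 * (K * τ u)) hu hp.le ?_ hp.le ?_ (by omega) hd (by omega))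
    · have := axis_translate hp (-k)
      rw [zpow_neg, zpow_natCast] at this
      exact this.le
    · have := axis_translate hp k
      rw [zpow_natCast] at this
      exact this.le

theorem D_pow_mul_ge {u R p : FreeGroup S} {K : ℤ} (hu : u ≠ 1) (hp : D p (u * p) = τ u)
    (hK : 0 ≤ K) (hR : D p (R * p) ≤ K * τ u) (a b : ℕ) :
    a * τ u + D p (R * (u ^ b * p)) - (50 * K + 12) * τ u ≤ D p (u ^ a * (R * (u ^ b * p))) := by
  have := gp_backtrack hu hp hK hR a b
  unfold gp at this
  rw [D_inv_self, D_pow_axis hp, D_inv_left] at this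
  linarith

theorem D_mul_pow_ge {u R p : FreeGroup S} {K : ℤ} (hp : D p (u * p) = τ u)
    (hR : D p (R * p) ≤ K * τ u) (b : ℕ) :
    (b - K) * τ u ≤ D p (R * (u ^ b * p)) := by
  have h1 := D_triangle (R * p) p (R * (u ^ b * p))
  rw [D_mul_left, D_pow_axis hp, D_comm (R * p) p] at h1
  linarith

theorem τ_pow_mul_ge {u R p : FreeGroup S} {K : ℤ} (hu : u ≠ 1) (hp : D p (u * p) = τ u)
    (hK : 0 ≤ K) (hR : D p (R * p) ≤ K * τ u) (N : ℕ) :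
    (N - (53 * K + 12)) * τ u ≤ τ (u ^ N * R) := by
  have h1 := D_pow_mul_ge hu hp hK hR N N
  have h2 := D_mul_pow_ge hp hR N
  have h3 : D p (u ^ N * R * p) ≤ (N + K) * τ u := by
    have := D_mul_mul_le p (u ^ N) R
    rw [D_pow_axis hp] at this
    linarith
  have h4 := D_triangle p (u ^ N * R * (u ^ N * R * p)) (u ^ N * (R * (u ^ N * p)))
  have h5 : D (u ^ N * R * (u ^ N * R * p)) (u ^ N * (R * (u ^ N * p))) = D p (R * p) := by
    have : u ^ N * (R * (u ^ N * p)) = u ^ N * R * u ^ N * p := by simp only [mul_assoc]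
    rw [this, show u ^ N * R * (u ^ N * R * p) = u ^ N * R * u ^ N * (R * p) by
      simp only [mul_assoc], D_mul_left, D_comm]
  rw [τ_eq p (u ^ N * R)]
  linarith

theorem τ_eq_sub_gp (x W : FreeGroup S) : τ W = D x (W * x) - gp x (W⁻¹ * x) (W * x) := by
  unfold gp
  rw [τ_eq x W, D_inv_self, D_inv_left]
  ring

/-- A long initial piece of the axis of `u` lies on the axis of `u ^ N * R`. -/
theorem exists_segment_on_axis {u R p : FreeGroup S} {K : ℤ} {N : ℕ} (hu : u ≠ 1)
    (hp : D p (u * p) = τ u) (hK : 0 ≤ K) (hR : D p (R * p) ≤ K * τ u)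
    (hN : 30 * (51 * K + 12) ≤ N) :
    ∃ a b, D a (u * a) = τ u ∧ D b (u * b) = τ u ∧
      D a (u ^ N * R * a) = τ (u ^ N * R) ∧
      D a b + D b (u ^ N * R * a) = τ (u ^ N * R) ∧
      9 * τ (u ^ N * R) ≤ 10 * D a b ∧ 15 * τ u ≤ τ (u ^ N * R) := by
  have hl := τ_pos hu
  obtain ⟨J, hJ⟩ := Int.eq_ofNat_of_zero_le (show 0 ≤ 51 * K + 12 by omega)
  have hJN : 30 * J ≤ N := by rw [hJ] at hN; exact_mod_cast hN
  have hJ0 : 12 ≤ J := by omega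
  obtain ⟨M, rfl⟩ := Nat.exists_eq_add_of_le (show J ≤ N by omega)
  set N := J + M with hNdef
  set W := u ^ N * R with hW
  have hKl : 0 ≤ K * τ u := by positivity
  have hJl : (J : ℤ) * τ u = 51 * (K * τ u) + 12 * τ u := by rw [← hJ]; ring
  -- distances from a point of the axis of `u`
  have dWx : ∀ i j : ℕ, i ≤ N → (N - i) * τ u + D p (R * (u ^ j * p)) - (50 * K + 12) * τ u ≤
      D (u ^ i * p) (W * (u ^ j * p)) := by
    intro i j hi
    have := D_pow_mul_ge hu hp hK hR (N - i) j
    have e : D (u ^ i * p) (W * (u ^ j * p)) = D p (u ^ (N - i) * (R * (u ^ j * p))) := by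
      rw [← D_mul_left (u ^ i) p]
      congr 1
      rw [← mul_assoc (u ^ i), ← pow_add, Nat.add_sub_cancel' hi, hW]
      simp only [mul_assoc]
    rw [e]
    push_cast [hi] at this
    exact this
  have dq : ∀ j : ℕ, D (u ^ N * p) (W * (u ^ j * p)) = D p (R * (u ^ j * p)) := by
    intro j
    rw [hW, mul_assoc, D_mul_left]
  have dax : ∀ i j : ℕ, i ≤ j → D (u ^ i * p) (u ^ j * p) = (j - i) * τ u := by
    intro i j hij
    have := D_zpow_axis' hp i j
    rw [zpow_natCast, zpow_natCast, abs_of_nonneg (by omega)] at this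
    exact this
  have hWa : ∀ j : ℕ, J ≤ j → j + J ≤ N →
      D (u ^ j * p) (W * (u ^ j * p)) = τ W := by
    intro j h1 h2
    have g1 := gp_min (u ^ j * p) (W⁻¹ * (u ^ j * p)) (W * (u ^ j * p)) 1
    have e0 : D p (u ^ j * p) = j * τ u := D_pow_axis hp j
    have e1 := dax j N (by omega)
    have e2 := dax 0 N (by omega)
    rw [pow_zero, one_mul] at e2
    have e3 := dWx j j (by omega)
    have e4 := D_mul_pow_ge hp hR j
    have e5 := dq j
    have e6 : D (W * p) (u ^ j * p) ≤ K * τ u + (N - j) * τ u := by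
      have t := D_triangle (W * p) (u ^ N * p) (u ^ j * p)
      have t1 := D_comm (u ^ j * p) (u ^ N * p)
      have t2 : D (W * p) (u ^ N * p) = D p (R * p) := by
        rw [hW, mul_assoc, D_mul_left, D_comm]
      linarith
    have m1 : 0 < gp (u ^ j * p) (u ^ N * p) (W * (u ^ j * p)) := by
      unfold gp
      have : (J : ℤ) * τ u ≤ (N - j) * τ u := by
        gcongr
        omega
      linarith
    have m2 : 0 < gp (u ^ j * p) p (W⁻¹ * (u ^ j * p)) := by
      unfold gp
      rw [D_inv_self, D_inv_right, D_comm (u ^ j * p) p]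
      have : (J : ℤ) * τ u ≤ j * τ u := by
        gcongr
      linarith
    have m3 : gp (u ^ j * p) p (u ^ N * p) = 0 := by
      unfold gp
      rw [D_comm (u ^ j * p) p]
      push_cast at e2
      linarith
    have m4 := gp_min (u ^ j * p) p (u ^ N * p) (W⁻¹ * (u ^ j * p))
    have m5 := gp_min (u ^ j * p) (W⁻¹ * (u ^ j * p)) (u ^ N * p) (W * (u ^ j * p))
    have m6 := gp_comm (u ^ j * p) (u ^ N * p) (W * (u ^ j * p))
    have m7 := gp_nonneg (u ^ j * p) (W⁻¹ * (u ^ j * p)) (W * (u ^ j * p))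
    have m8 := τ_eq_sub_gp (u ^ j * p) W
    omega
  have hLlow : (N - J) * τ u ≤ τ W := by
    have h := hWa J le_rfl (by omega)
    have e3 := dWx J J (by omega)
    have e4 := D_mul_pow_ge hp hR J
    linarith
  have hLup : τ W ≤ (N + K) * τ u := by
    have := τ_le p W
    have h2 := D_mul_mul_le p (u ^ N) R
    rw [D_pow_axis hp] at h2
    rw [← hW] at h2
    linarith
  have hab := dax J M (by omega)
  have hNM : (N : ℤ) = J + M := by rw [hNdef]; push_cast; ring
  have hNl : 30 * (J * τ u) ≤ N * τ u := by
    have : (30 * J : ℤ) * τ u ≤ N * τ u := by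
      gcongr
      exact_mod_cast hJN
    linarith
  refine ⟨u ^ J * p, u ^ M * p, ?_, ?_, ?_, ?_, ?_, ?_⟩
  · have := axis_translate hp J
    rwa [zpow_natCast] at this
  · have := axis_translate hp M
    rwa [zpow_natCast] at this
  · exact hWa J le_rfl (by omega)
  · have e0 : D p (u ^ M * p) = M * τ u := D_pow_axis hp M
    have e0' : D p (u ^ J * p) = J * τ u := D_pow_axis hp J
    have e0'' : D p (u ^ N * p) = N * τ u := D_pow_axis hp N
    have e1 := dax M N (by omega)
    have e2 := dWx M J (by omega)
    have e3 := dq J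
    have m1 : 0 < gp (u ^ M * p) (u ^ N * p) (W * (u ^ J * p)) := by
      unfold gp
      have r1 : ((N : ℤ) - M) * τ u = J * τ u := by rw [hNM]; ring
      linarith
    have c1 := D_comm (u ^ M * p) p
    have c2 := D_comm (u ^ M * p) (u ^ J * p)
    have hMJ : 0 < ((M : ℤ) - J) * τ u := by
      have : (0 : ℤ) < M - J := by omega
      positivity
    have m2 : 0 < gp (u ^ M * p) p (u ^ J * p) := by
      unfold gp
      linarith
    have m3 : gp (u ^ M * p) p (u ^ N * p) = 0 := by
      unfold gp
      linarith
    have m4 := gp_min (u ^ M * p) p (u ^ N * p) (u ^ J * p)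
    have m5 := gp_min (u ^ M * p) (u ^ J * p) (u ^ N * p) (W * (u ^ J * p))
    have m6 := gp_comm (u ^ M * p) (u ^ N * p) (W * (u ^ J * p))
    have m7 := gp_nonneg (u ^ M * p) (u ^ J * p) (W * (u ^ J * p))
    have m8 : gp (u ^ M * p) (u ^ J * p) (W * (u ^ J * p)) = 0 := by omega
    have m9 := hWa J le_rfl (by omega)
    unfold gp at m8
    omega
  · rw [hab]
    have : (N : ℤ) * τ u = J * τ u + M * τ u := by rw [hNM]; ring
    linarith
  · linarith

theorem exists_between_translates {a a' W : FreeGroup S} (hW : W ≠ 1) (ha : D a (W * a) = τ W)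
    (ha' : D a' (W * a') = τ W) :
    ∃ i : ℤ, D (W ^ i * a) a' + D a' (W * (W ^ i * a)) = τ W := by
  have hL := τ_pos hW
  set d := D a a' with hd
  have hd0 : 0 ≤ d := D_nonneg _ _
  obtain ⟨n, hn⟩ := Int.eq_ofNat_of_zero_le (show 0 ≤ d + 1 by omega)
  have hnL : d + 1 ≤ n * τ W := by
    have : (n : ℤ) * 1 ≤ n * τ W := by gcongr
    omega
  have e1 : D a' (W ^ n * a') = n * τ W := D_pow_axis ha' n
  have e2 : D a' ((W ^ n)⁻¹ * a') = n * τ W := by rw [D_inv_self, e1]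
  have e3 : D ((W ^ n)⁻¹ * a') (W ^ n * a') = 2 * (n * τ W) := by
    rw [D_inv_left, ← mul_assoc, ← pow_add, D_pow_axis ha']; push_cast; ring
  have e4 : D ((W ^ n)⁻¹ * a') ((W ^ n)⁻¹ * a) = d := by rw [D_mul_left, D_comm]
  have e5 : D (W ^ n * a') (W ^ n * a) = d := by rw [D_mul_left, D_comm]
  have e6 : D ((W ^ n)⁻¹ * a) (W ^ n * a) = 2 * (n * τ W) := by
    rw [D_inv_left, ← mul_assoc, ← pow_add, D_pow_axis ha]; push_cast; ring
  have t1 := D_triangle a' (W ^ n * a) (W ^ n * a')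
  have t2 := D_triangle a' ((W ^ n)⁻¹ * a) ((W ^ n)⁻¹ * a')
  have c1 := D_comm (W ^ n * a') (W ^ n * a)
  have c2 := D_comm ((W ^ n)⁻¹ * a') ((W ^ n)⁻¹ * a)
  have m1 := gp_min a' ((W ^ n)⁻¹ * a') (W ^ n * a') ((W ^ n)⁻¹ * a)
  have m2 := gp_min a' ((W ^ n)⁻¹ * a) (W ^ n * a') (W ^ n * a)
  have m3 := gp_nonneg a' ((W ^ n)⁻¹ * a) (W ^ n * a)
  have hmem : D ((W ^ n)⁻¹ * a) a' + D a' (W ^ n * a) = D ((W ^ n)⁻¹ * a) (W ^ n * a) := by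
    have c3 := D_comm a' ((W ^ n)⁻¹ * a)
    unfold gp at *
    omega
  set t := D ((W ^ n)⁻¹ * a) a' with ht
  have ht0 : 0 ≤ t := D_nonneg _ _
  have htlt : t < 2 * (n * τ W) := by
    have c3 := D_comm a' ((W ^ n)⁻¹ * a)
    have := D_nonneg a' (W ^ n * a)
    omega
  set j := t / τ W with hj
  have hj0 : 0 ≤ j := Int.ediv_nonneg ht0 (by omega)
  have hj1 : j * τ W ≤ t := Int.ediv_mul_le _ (by omega)
  have hj2 : t < (j + 1) * τ W := Int.lt_ediv_add_one_mul_self _ (by omega)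
  have hj3 : j + 1 ≤ 2 * n := by
    by_contra! hlt
    have : (2 * n : ℤ) * τ W ≤ j * τ W := by
      gcongr
      omega
    linarith
  have par : ∀ k : ℤ, 0 ≤ k → k ≤ 2 * n →
      D ((W ^ n)⁻¹ * a) (W ^ (k - n) * a) = k * τ W ∧
      D ((W ^ n)⁻¹ * a) (W ^ (k - n) * a) + D (W ^ (k - n) * a) (W ^ n * a) =
        D ((W ^ n)⁻¹ * a) (W ^ n * a) := by
    intro k hk0 hk
    have f1 := D_zpow_axis' ha (-n) (k - n)
    have f2 := D_zpow_axis' ha (k - n) n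
    rw [zpow_neg, zpow_natCast, abs_of_nonneg (by omega)] at f1
    rw [zpow_natCast, abs_of_nonneg (by omega)] at f2
    rw [f1, f2, e6]
    constructor <;> ring
  obtain ⟨p1, p2⟩ := par j hj0 (by omega)
  obtain ⟨q1, q2⟩ := par (j + 1) (by omega) hj3
  have r1 := D_of_mem p2 hmem
  have r2 := D_of_mem hmem q2
  refine ⟨j - n, ?_⟩
  have : W * (W ^ (j - n) * a) = W ^ (j + 1 - n) * a := by
    rw [← mul_assoc, ← zpow_one_add]; congr 2; ring
  rw [this, r1, r2, p1, q1, ← ht, abs_of_nonpos (by omega), abs_of_nonpos (by omega)]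
  ring

theorem commute_of_overlap {u v W a b a' b' : FreeGroup S}
    (hau : D a (u * a) = τ u) (hbu : D b (u * b) = τ u) (hav : D a' (v * a') = τ v)
    (hbv : D b' (v * b') = τ v) (ha : D a (W * a) = τ W) (ha' : D a' (W * a') = τ W)
    (hb : D a b + D b (W * a) = τ W) (hb' : D a' b' + D b' (W * a') = τ W)
    (hab : 9 * τ W ≤ 10 * D a b) (hab' : 9 * τ W ≤ 10 * D a' b')
    (hLu : 15 * τ u ≤ τ W) (hLv : 15 * τ v ≤ τ W) (hu : u ≠ 1)
    (hmem : D a a' + D a' (W * a) = τ W) (hhalf : 2 * D a a' ≤ τ W) : Commute u v := by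
  have hlu := τ_pos hu
  set l := max (τ u) (τ v) with hl
  set c := D a a' with hc
  have hc0 : 0 ≤ c := D_nonneg _ _
  obtain ⟨f, f1, f2⟩ := exists_between a b (k := c + 6 * l) (by omega) (by omega)
  have f3 : D f (W * a) = τ W - c - 6 * l := by
    have h1 := D_triangle f b (W * a)
    have h2 := D_triangle a f (W * a)
    omega
  have g1 := D_of_mem (a := a) (b := W * a) (x := a') (y := f) (by omega) (by omega)
  have g2 := D_of_mem (a := a) (b := W * a) (x := a') (y := b) (by omega) (by omega)
  have g3 : D (W * a) (W * a') = c := D_mul_left _ _ _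
  have g4 : D a' f = 6 * l := by
    rw [g1, ← hc, f1, abs_of_nonpos (by omega)]; ring
  have g5 : D a' b = D a b - c := by
    rw [g2, ← hc, abs_of_nonpos (by omega)]; ring
  have g6 : D a' f + D f (W * a') = τ W := by
    have h1 := D_triangle f (W * a) (W * a')
    have h2 := D_triangle a' f (W * a')
    omega
  have g7 := D_of_mem (a := a') (b := W * a') (x := f) (y := b') (by omega) (by omega)
  have g8 : D f b' = D a' b' - 6 * l := by
    rw [g7, g4, abs_of_nonpos (by omega)]; ring
  have u1 := D_convex u (p := a) (q := b) (e := a') (by omega)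
  have u2 := D_convex u (p := a) (q := b) (e := f) (by omega)
  have v2 := D_convex v (p := a') (q := b') (e := f) (by omega)
  exact commute_of_displace (p := a') (q := f) (R := l) (by omega) (by omega) (by omega)
    (by omega) (by omega)

/-- If `u ^ N * R = v ^ N * R'` with long exponent, then `u` and `v` have essentially the same
axis, up to translating by a power of the common value. -/
theorem exists_commute_conj {u v R R' p p' : FreeGroup S} {K : ℤ} {N : ℕ} (hu : u ≠ 1)
    (hv : v ≠ 1) (hp : D p (u * p) = τ u) (hp' : D p' (v * p') = τ v) (hK : 0 ≤ K)
    (hR : D p (R * p) ≤ K * τ u) (hR' : D p' (R' * p') ≤ K * τ v)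
    (hN : 30 * (51 * K + 12) ≤ N) (hW : u ^ N * R = v ^ N * R') :
    ∃ i : ℤ, Commute ((u ^ N * R) ^ i * u * ((u ^ N * R) ^ i)⁻¹) v := by
  obtain ⟨a, b, hau, hbu, ha, hb, hab, hLu⟩ := exists_segment_on_axis hu hp hK hR hN
  obtain ⟨a', b', hav, hbv, ha', hb', hab', hLv⟩ := exists_segment_on_axis hv hp' hK hR' hN
  rw [← hW] at ha' hb' hab' hLv
  set W := u ^ N * R with hWdef
  have hlu := τ_pos hu
  have hW1 : W ≠ 1 := by
    intro h
    rw [h, τ_one] at hLu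
    omega
  obtain ⟨i, hi⟩ := exists_between_translates hW1 ha ha'
  set g := W ^ i with hg
  have hgW : Commute g W := (Commute.refl W).zpow_left i
  have k1 := axis_conj hau g
  have k2 := axis_conj hbu g
  have k3 : D (g * a) (W * (g * a)) = τ W := by
    rw [← ha, ← mul_assoc, ← hgW.eq, mul_assoc, D_mul_left]
  have k4 : D (g * b) (W * (g * a)) = D b (W * a) := by
    rw [← mul_assoc, ← hgW.eq, mul_assoc, D_mul_left]
  have k5 : D (g * a) (g * b) = D a b := D_mul_left _ _ _
  have k6 : τ (g * u * g⁻¹) = τ u := τ_conj _ _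
  have k7 : g * u * g⁻¹ ≠ 1 := by
    intro h
    rw [h, τ_one] at k6
    omega
  by_cases hhalf : 2 * D (g * a) a' ≤ τ W
  · have := commute_of_overlap k1 k2 hav hbv k3 ha' (by omega) hb' (by omega) hab' (by omega)
      hLv k7 hi hhalf
    exact ⟨i, this⟩
  · have n1 := axis_conj k1 W
    have n2 := axis_conj k2 W
    have n3 : D (W * (g * a)) (W * (W * (g * a))) = τ W := by rw [D_mul_left, k3]
    have n4 : D (W * (g * a)) (W * (g * b)) = D a b := by rw [D_mul_left, k5]
    have n5 : D (W * (g * b)) (W * (W * (g * a))) = D b (W * a) := by rw [D_mul_left, k4]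
    have n6 : τ (W * (g * u * g⁻¹) * W⁻¹) = τ u := by rw [τ_conj, k6]
    have n7 : D (W * (g * a)) (W * a') = D (g * a) a' := D_mul_left _ _ _
    have := commute_of_overlap hav hbv n1 n2 ha' n3 hb' (by omega) hab' (by omega) hLv (by omega)
      hv (by omega) (by omega)
    refine ⟨1 + i, ?_⟩
    rw [zpow_one_add, ← hg, show W * g * u * (W * g)⁻¹ = W * (g * u * g⁻¹) * W⁻¹ by
      simp only [mul_inv_rev, mul_assoc]]
    exact this.symm

theorem commute_of_pow_eq {u R p v : FreeGroup S} {K : ℤ} {N k : ℕ} (hu : u ≠ 1)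
    (hp : D p (u * p) = τ u) (hK : 0 ≤ K) (hR : D p (R * p) ≤ K * τ u)
    (hN : 30 * (51 * K + 12) ≤ N) (hk : 2 ≤ k) (hW : u ^ N * R = v ^ k) : Commute R u := by
  have hv1 : v * u * v⁻¹ ≠ 1 := by
    intro h
    have := τ_conj v u
    rw [h, τ_one] at this
    have := τ_pos hu
    omega
  have hR' : D (v * p) (v * R * v⁻¹ * (v * p)) ≤ K * τ (v * u * v⁻¹) := by
    rw [τ_conj, show v * R * v⁻¹ * (v * p) = v * (R * p) by group, D_mul_left]
    exact hR
  have hW' : u ^ N * R = (v * u * v⁻¹) ^ N * (v * R * v⁻¹) := by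
    have : (v * u * v⁻¹) ^ N * (v * R * v⁻¹) = v * (u ^ N * R) * v⁻¹ := by
      rw [conj_pow]; group
    rw [this, hW, ((Commute.refl v).pow_right k).eq, mul_inv_cancel_right]
  obtain ⟨i, hi⟩ := exists_commute_conj hu hv1 hp (axis_conj hp v) hK hR hR' hN hW'
  rw [hW] at hi
  have h1 : Commute (v⁻¹ * (v ^ k) ^ i * u * (v⁻¹ * (v ^ k) ^ i)⁻¹) u := by
    have h2 := congrArg (fun x => v⁻¹ * x * v) hi.eq
    have e1 : v⁻¹ * ((v ^ k) ^ i * u * ((v ^ k) ^ i)⁻¹ * (v * u * v⁻¹)) * v =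
        v⁻¹ * (v ^ k) ^ i * u * (v⁻¹ * (v ^ k) ^ i)⁻¹ * u := by group
    have e2 : v⁻¹ * (v * u * v⁻¹ * ((v ^ k) ^ i * u * ((v ^ k) ^ i)⁻¹)) * v =
        u * (v⁻¹ * (v ^ k) ^ i * u * (v⁻¹ * (v ^ k) ^ i)⁻¹) := by group
    simp only [e1, e2] at h2
    exact h2
  have h3 := commute_of_conj hu h1
  have h4 : v⁻¹ * (v ^ k) ^ i = v ^ (k * i - 1) := by
    rw [← zpow_natCast, ← zpow_mul, zpow_sub_one]
    exact ((Commute.refl v).inv_left.zpow_right _).eq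
  have h5 : (k : ℤ) * i - 1 ≠ 0 := by
    intro h
    have hk1 : (k : ℤ) = 1 ∨ (k : ℤ) = -1 := Int.isUnit_iff.1 (IsUnit.of_mul_eq_one i (by omega))
    omega
  rw [h4] at h3
  have h6 : Commute u v := commute_of_zpow h5 h3.symm
  have h7 : R = (u ^ N)⁻¹ * v ^ k := by rw [← hW]; group
  rw [h7]
  exact (((Commute.refl u).pow_left N).inv_left).mul_left (h6.symm.pow_left k)

theorem commute_left_of_commute {u g R R' p : FreeGroup S} {K : ℤ} {N : ℕ} (hu : u ≠ 1)
    (hp : D p (u * p) = τ u) (hK : 0 ≤ K) (hg : D p (g * p) ≤ K * τ u)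
    (hR' : D p (R' * p) ≤ K * τ u) (hN : 8 * K + 6 ≤ N) (hR : R = g * u ^ N * R')
    (hc : Commute R u) : Commute g u := by
  have hl := τ_pos hu
  have hKl : 0 ≤ K * τ u := by positivity
  have e1 : D (g * p) (g * (u ^ N * p)) = N * τ u := by rw [D_mul_left, D_pow_axis hp]
  have a1 := D_displace (g * p) p u
  have c1 := D_comm (g * p) p
  have hx : g * (u ^ N * p) = R * (R'⁻¹ * p) := by rw [hR]; group
  have a2 : D (g * (u ^ N * p)) (u * (g * (u ^ N * p))) ≤ τ u + 2 * (K * τ u) := by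
    have h1 := D_displace (R'⁻¹ * p) p u
    rw [hx, ← mul_assoc u R, ← hc.eq, mul_assoc R u, D_mul_left]
    have h2 : D (R'⁻¹ * p) p = D p (R' * p) := by rw [D_inv_left]
    omega
  have b1 : D (g * p) (g * u * g⁻¹ * (g * p)) ≤ τ u := by
    rw [axis_conj hp g, τ_conj]
  have b2 : D (g * (u ^ N * p)) (g * u * g⁻¹ * (g * (u ^ N * p))) ≤ τ u := by
    have h := axis_translate hp N
    rw [zpow_natCast] at h
    rw [axis_conj h g, τ_conj]
  have hN' : (8 * K + 6) * τ u ≤ N * τ u := by gcongr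
  exact commute_of_conj hu (commute_of_displace (p := g * p) (q := g * (u ^ N * p))
    (R := τ u + 2 * (K * τ u)) (by omega) (by omega) (by omega) a2 (by linarith))

theorem commute_of_mul_pow_eq {u g h R R' p : FreeGroup S} {K : ℤ} {N : ℕ} (hu : u ≠ 1)
    (hp : D p (u * p) = τ u) (hg : D p (g * p) ≤ K * τ u)
    (hh : D p (h * p) ≤ K * τ u) (hR : D p (R * p) ≤ K * τ u)
    (hR' : D p (R' * p) ≤ K * τ u) (hN : 16 * K + 6 ≤ N) (heq : g * u ^ N * R = h * u ^ N * R') :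
    Commute (g⁻¹ * h) u := by
  have hl := τ_pos hu
  have hax := axis_translate hp N
  rw [zpow_natCast] at hax
  have hN' : (16 * K + 6) * τ u ≤ N * τ u := by gcongr
  refine commute_of_fellow (a := p) (b := u ^ N * p) (a' := p) (b' := u ^ N * p) (l := τ u)
    (ρ := 2 * (K * τ u)) hu hp.le hax.le hp.le hax.le ?_ ?_ ?_
  · have h1 := D_mul_mul_le p g⁻¹ h
    rw [D_inv_self] at h1
    linarith
  · have h1 : g⁻¹ * h * (u ^ N * p) = u ^ N * R * (R'⁻¹ * p) := by
      have : g⁻¹ * h * u ^ N = u ^ N * R * R'⁻¹ := by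
        rw [eq_mul_inv_iff_mul_eq, mul_assoc, mul_assoc, inv_mul_eq_iff_eq_mul, ← mul_assoc,
          ← mul_assoc, heq]
      rw [← mul_assoc, this]
      simp only [mul_assoc]
    rw [h1, mul_assoc, D_mul_left]
    have h2 := D_mul_mul_le p R R'⁻¹
    rw [D_inv_self, mul_assoc] at h2
    linarith
  · rw [D_pow_axis hp]
    linarith

theorem gp_le_of_not_commute {u t R p p' : FreeGroup S} {K L : ℤ} {N : ℕ}
    {Q : FreeGroup S} (hu : u ≠ 1)
    (hp : D p (u * p) = τ u) (hp' : D p' (u * p') = τ u) (hK : 0 ≤ K)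
    (ht : D p (t * p) ≤ K * τ u) (hR : D p (R * p) ≤ L * τ u) (hQ : Q = t * u ^ N * R)
    (htu : ¬ Commute t u) (hN : 9 * K + L + 6 ≤ N) :
    gp p p' (Q * p) < 2 * ((8 * K + 6) * τ u) := by
  by_contra! hgp
  have hl := τ_pos hu
  have hKl : 0 ≤ K * τ u := by positivity
  have hr : (8 * K + 6) * τ u = 8 * (K * τ u) + 6 * τ u := by ring
  have hNl : (9 * K + L + 6) * τ u ≤ N * τ u := by gcongr
  have hr' : (9 * K + L + 6) * τ u = 9 * (K * τ u) + L * τ u + 6 * τ u := by ring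
  have g1 := gp_le_left p p' (Q * p)
  have g2 := gp_le_right p p' (Q * p)
  obtain ⟨f, f1, f2⟩ := exists_between p p' (k := (8 * K + 6) * τ u) (by omega) (by omega)
  have w1 : D (t * p) (t * u * t⁻¹ * (t * p)) = τ u := by rw [axis_conj hp t, τ_conj]
  have w2 := D_displace p (t * p) (t * u * t⁻¹)
  have w3 : D (t * (u ^ N * p)) (t * u * t⁻¹ * (t * (u ^ N * p))) = τ u := by
    have h := axis_translate hp N
    rw [zpow_natCast] at h
    rw [axis_conj h t, τ_conj]
  have w5 : D (Q * p) (t * (u ^ N * p)) = D p (R * p) := by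
    rw [hQ, show t * u ^ N * R * p = t * (u ^ N * (R * p)) by simp only [mul_assoc], D_mul_left,
      D_mul_left, D_comm]
  have w6 : D (t * p) (t * (u ^ N * p)) = N * τ u := by rw [D_mul_left, D_pow_axis hp]
  have w7 := D_triangle (t * p) p (t * (u ^ N * p))
  have w8 := D_triangle p (Q * p) (t * (u ^ N * p))
  have c1 := D_comm (t * p) p
  have m1 := gp_min p f (Q * p) p'
  have m2 := gp_min p f (t * (u ^ N * p)) (Q * p)
  have hf : D p f + D f (t * (u ^ N * p)) = D p (t * (u ^ N * p)) := by
    have := D_triangle p f (t * (u ^ N * p))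
    unfold gp at *
    omega
  have u2 := D_convex u (p := p) (q := p') (e := f) (by omega)
  have v2 := D_convex (t * u * t⁻¹) hf
  exact htu (commute_of_conj hu (commute_of_displace (p := p) (q := f)
    (R := τ u + 2 * (K * τ u)) (by omega) (by omega) (by omega) (by omega) (by omega)))

theorem D_axis_le_of_not_commute {u t t' R R' p p' Q : FreeGroup S} {K L : ℤ} {N : ℕ} (hu : u ≠ 1)
    (hp : D p (u * p) = τ u) (hp' : D p' (u * p') = τ u) (hK : 0 ≤ K)
    (ht : D p (t * p) ≤ K * τ u) (hR : D p (R * p) ≤ L * τ u) (hQ : Q = t * u ^ N * R)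
    (htu : ¬ Commute t u) (ht' : D p' (t' * p') ≤ K * τ u) (hR' : D p' (R' * p') ≤ L * τ u)
    (hQ' : Q = t' * u ^ N * R') (htu' : ¬ Commute t' u) (hN : 40 * K + L + 30 ≤ N) :
    D p p' ≤ (16 * K + 12) * τ u := by
  have hl := τ_pos hu
  have hKl : 0 ≤ K * τ u := by positivity
  have g1 := gp_le_of_not_commute hu hp hp' hK ht hR hQ htu (by omega)
  have g2 := gp_le_of_not_commute hu hp' hp hK ht' hR' hQ' htu' (by omega)
  have h1 := D_four p (Q * p') p' (Q * p)
  have h2 : D (Q * p) (Q * p') = D p p' := D_mul_left _ _ _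
  have h3 : (N - (K + L)) * τ u ≤ D p (Q * p) := by
    have a1 := D_triangle (t * p) p (t * (u ^ N * p))
    have a2 := D_triangle p (Q * p) (t * (u ^ N * p))
    have a3 : D (Q * p) (t * (u ^ N * p)) = D p (R * p) := by
      rw [hQ, show t * u ^ N * R * p = t * (u ^ N * (R * p)) by simp only [mul_assoc], D_mul_left,
        D_mul_left, D_comm]
    have a4 : D (t * p) (t * (u ^ N * p)) = N * τ u := by rw [D_mul_left, D_pow_axis hp]
    have a5 := D_comm (t * p) p
    linarith
  have hNl : (40 * K + L + 30) * τ u ≤ N * τ u := by gcongr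
  have e1 : (40 * K + L + 30) * τ u = 40 * (K * τ u) + L * τ u + 30 * τ u := by ring
  have e2 : (N - (K + L)) * τ u = N * τ u - K * τ u - L * τ u := by ring
  have e3 : (16 * K + 12) * τ u = 16 * (K * τ u) + 12 * τ u := by ring
  have e4 : (8 * K + 6) * τ u = 8 * (K * τ u) + 6 * τ u := by ring
  have c1 := D_comm p p'
  have c2 := D_comm (Q * p) (Q * p')
  have c3 := D_comm (Q * p') p'
  have c4 := D_comm p' (Q * p)
  have n1 := D_nonneg p' (Q * p')
  unfold gp at *
  omega

theorem exists_minimizer {α : Type*} (P : α → Prop) (f : α → ℤ) (hf : ∀ a, 0 ≤ f a)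
    (hP : ∃ a, P a) : ∃ a, P a ∧ ∀ b, P b → f a ≤ f b := by
  classical
  have hex : ∃ n : ℕ, ∃ a, P a ∧ f a = n := by
    obtain ⟨a, ha⟩ := hP
    exact ⟨(f a).toNat, a, ha, (Int.toNat_of_nonneg (hf a)).symm⟩
  obtain ⟨a, ha, hfa⟩ := Nat.find_spec hex
  refine ⟨a, ha, fun b hb => ?_⟩
  have := Nat.find_min' hex ⟨b, hb, (Int.toNat_of_nonneg (hf b)).symm⟩
  have h2 := hf b
  omega

theorem gp_pow_lt {X Z p : FreeGroup S} (hp : D p (X * p) = τ X)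
    (hmin : ∀ q, D q (X * q) = τ X → D p (Z * p) ≤ D q (Z * q)) (hτ : τ Z = τ X)
    (hXZ : ¬ Commute X Z) (m : ℕ) : gp p (X ^ m * p) (Z ^ m * p) < 12 * τ X := by
  by_contra! hgp
  have hX : X ≠ 1 := by rintro rfl; exact hXZ (Commute.one_left Z)
  have hl := τ_pos hX
  have g1 := gp_le_left p (X ^ m * p) (Z ^ m * p)
  have g2 := gp_le_right p (X ^ m * p) (Z ^ m * p)
  have dX := D_pow_axis hp m
  obtain ⟨q, q1, q2⟩ := exists_between p (X ^ m * p) (k := 6 * τ X) (by omega) (by omega)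
  have hXm := axis_translate hp m
  rw [zpow_natCast] at hXm
  have hm : m ≠ 0 := by
    rintro rfl
    simp [gp, D_self] at hgp
    omega
  obtain ⟨m', rfl⟩ : ∃ k, m = k + 1 := ⟨m - 1, by omega⟩
  have dZ := D_pow_succ p Z m'
  have hq : ∀ y, D p y + D y q = D p q → D p y + D y (X ^ (m' + 1) * p) = D p (X ^ (m' + 1) * p) ∧
      D p y + D y (Z ^ (m' + 1) * p) = D p (Z ^ (m' + 1) * p) := by
    intro y hy
    have t1 := D_triangle y q (X ^ (m' + 1) * p)
    have t2 := D_triangle p y (X ^ (m' + 1) * p)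
    have t3 := D_triangle p y (Z ^ (m' + 1) * p)
    have m1 := gp_min p y (Z ^ (m' + 1) * p) (X ^ (m' + 1) * p)
    have n1 := D_nonneg y q
    unfold gp at *
    omega
  have hZq : D q (Z * q) ≤ D p (Z * p) := by
    have := D_convex Z (hq q (by rw [D_self]; ring)).2
    have e : D (Z ^ (m' + 1) * p) (Z * (Z ^ (m' + 1) * p)) = D p (Z * p) := by
      rw [show Z * (Z ^ (m' + 1) * p) = Z ^ (m' + 1) * (Z * p) by
        rw [← mul_assoc, ← pow_succ', pow_succ, mul_assoc], D_mul_left]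
    omega
  have h0 : D p (Z * p) = τ X := by
    by_contra hne
    have hle := τ_le p Z
    obtain ⟨p', hp'1, hp'2⟩ := exists_axis p Z
    obtain ⟨y, y1, y2⟩ := exists_between p q (k := 1) (by omega) (by omega)
    obtain ⟨y3, y4⟩ := hq y (by omega)
    have hyX : D y (X * y) = τ X := by
      have := D_convex X y3
      have := τ_le y X
      omega
    have hp'm : D p p' + D p' (Z ^ (m' + 1) * p) = D p (Z ^ (m' + 1) * p) := by
      have t1 := D_triangle p' (Z ^ (m' + 1) * p') (Z ^ (m' + 1) * p)
      have t2 : D p' (Z ^ (m' + 1) * p') = τ Z + m' * τ Z := by rw [D_pow_succ, hp'1]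
      have t3 : D (Z ^ (m' + 1) * p') (Z ^ (m' + 1) * p) = D p p' := by rw [D_mul_left, D_comm]
      have t4 := D_triangle p p' (Z ^ (m' + 1) * p)
      omega
    have hyp' := D_of_mem y4 hp'm
    rw [abs_of_nonpos (by omega)] at hyp'
    have := D_displace y p' Z
    have := hmin y hyX
    omega
  have hXq : D q (X * q) ≤ τ X := by
    have := D_convex X (hq q (by rw [D_self]; ring)).1
    omega
  exact hXZ (commute_of_displace (p := p) (q := q) (R := τ X) (by omega) (by omega) (by omega)
    (by omega) (by omega))

theorem τ_le_τ_pow_mul {X Z : FreeGroup S} (hτ : τ Z = τ X) (hXZ : ¬ Commute X Z) :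
    τ X ≤ τ (X ^ 13 * (Z ^ 13)⁻¹) := by
  obtain ⟨p, hp, hmin⟩ := exists_minimizer (fun p => D p (X * p) = τ X) (fun p => D p (Z * p))
    (fun p => D_nonneg _ _) (by obtain ⟨p, hp, -⟩ := exists_axis 1 X; exact ⟨p, hp⟩)
  have hX : X ≠ 1 := by rintro rfl; exact hXZ (Commute.one_left Z)
  have hl := τ_pos hX
  have g1 := gp_pow_lt hp hmin hτ hXZ 13
  have g2 := gp_pow_lt (X := X⁻¹) (Z := Z⁻¹) (p := p) (by rw [D_inv_self, τ_inv, hp])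
    (by
      intro q hq
      rw [D_inv_self, τ_inv] at hq
      rw [D_inv_self, D_inv_self]
      exact hmin q hq) (by rw [τ_inv, τ_inv, hτ])
    (by rwa [Commute.inv_left_iff, Commute.inv_right_iff]) 13
  rw [τ_inv, inv_pow, inv_pow] at g2
  have dX := D_pow_axis hp 13
  have dZ := D_pow_succ p Z 12
  have hle := τ_le p Z
  norm_num at dX dZ
  set A := X ^ 13
  set B := Z ^ 13
  set g := A * B⁻¹ with hg
  have e1 : D p (A⁻¹ * p) = D p (A * p) := D_inv_self _ _
  have e2 : D p (B⁻¹ * p) = D p (B * p) := D_inv_self _ _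
  have e3 : D (A⁻¹ * p) (B⁻¹ * p) = D p (g * p) := by rw [D_inv_left, hg, mul_assoc]
  have e4 : D p (g⁻¹ * p) = D p (g * p) := D_inv_self _ _
  have e5 : D (g⁻¹ * p) (B * p) = D p (A * p) := by
    rw [hg, mul_inv_rev, inv_inv, mul_assoc, D_mul_left, D_inv_left, D_comm]
  have e6 : D (g * p) (A * p) = D p (B * p) := by
    rw [hg, mul_assoc, D_mul_left, D_inv_left]
  have m1 := gp_min p (A * p) (B * p) (g * p)
  have m2 := gp_min p (g * p) (B * p) (g⁻¹ * p)
  have c1 := D_comm (A * p) (g * p)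
  have c2 := D_comm (g⁻¹ * p) (g * p)
  have t := τ_eq_sub_gp p g
  unfold gp at *
  omega

/-- The commutator of the thirteenth powers; its translation length dominates those of both
arguments. -/
def powComm {G : Type*} [Group G] (x y : G) : G := x ^ 13 * y ^ 13 * (x ^ 13)⁻¹ * (y ^ 13)⁻¹

theorem map_powComm {G H : Type*} [Group G] [Group H] (f : G →* H) (x y : G) :
    f (powComm x y) = powComm (f x) (f y) := by
  simp [powComm]

theorem powComm_inv {G : Type*} [Group G] (x y : G) : (powComm x y)⁻¹ = powComm y x := by
  simp [powComm, mul_assoc]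

theorem powComm_eq_one {G : Type*} [Group G] {x y : G} (h : Commute x y) : powComm x y = 1 := by
  rw [powComm, (h.pow_pow 13 13).eq]
  group

theorem τ_powComm_ge {x y : FreeGroup S} (h : ¬ Commute x y) : τ x ≤ τ (powComm x y) := by
  have hx : x ≠ 1 := by rintro rfl; exact h (Commute.one_left y)
  have h1 : ¬ Commute x (y ^ 13 * x * (y ^ 13)⁻¹) := by
    intro h1
    have h2 := commute_of_conj hx h1.symm
    exact h (commute_of_zpow (n := 13) (by norm_num) (by exact_mod_cast h2.symm))
  have := τ_le_τ_pow_mul (τ_conj _ _) h1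
  rwa [conj_pow, show x ^ 13 * (y ^ 13 * x ^ 13 * (y ^ 13)⁻¹)⁻¹ = powComm x y by
    rw [powComm]; simp only [mul_inv_rev, inv_inv, mul_assoc]] at this

theorem τ_powComm_ge' {x y : FreeGroup S} (h : ¬ Commute x y) : τ y ≤ τ (powComm x y) := by
  rw [← powComm_inv, τ_inv]
  exact τ_powComm_ge fun h' => h h'.symm

theorem powComm_ne_one {x y : FreeGroup S} (h : ¬ Commute x y) : powComm x y ≠ 1 := by
  intro h1
  have h2 := τ_powComm_ge h
  rw [h1, τ_one] at h2
  have hx : x ≠ 1 := by rintro rfl; exact h (Commute.one_left y)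
  have := τ_pos hx
  omega

theorem gp_pos_of_τ_mul_le {y z p : FreeGroup S} {T : ℤ} (hT : 1 ≤ T)
    (hyy : τ (y * y) ≤ T) (hzz : τ (z * z) ≤ T) (hyz : τ (y * z) ≤ T)
    (hy : 5 * T < D p (y * p)) (hz : 5 * T < D p (z * p)) :
    2 ≤ gp p (y * p) (z * p) ∧ 2 ≤ gp p (y * p) (z⁻¹ * p) := by
  have ky := τ_eq_sub_gp p y
  have kz := τ_eq_sub_gp p z
  have kw := τ_eq_sub_gp p (y * z)
  have py := τ_pow y 2
  have pz := τ_pow z 2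
  rw [sq] at py pz
  push_cast at py pz
  have e1 : D p (y⁻¹ * p) = D p (y * p) := D_inv_self _ _
  have e2 : D p (z⁻¹ * p) = D p (z * p) := D_inv_self _ _
  have e3 : D (y⁻¹ * p) (z * p) = D p (y * z * p) := by rw [D_inv_left, mul_assoc]
  have e4 : D p ((y * z)⁻¹ * p) = D p (y * z * p) := D_inv_self _ _
  have e5 : D (y * z * p) (y * p) = D p (z * p) := by rw [mul_assoc, D_mul_left, D_comm]
  have e6 : D ((y * z)⁻¹ * p) (z⁻¹ * p) = D p (y * p) := by
    rw [mul_inv_rev, mul_assoc, D_mul_left, D_comm, e1]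
  have m1 := gp_min p (y * p) (z⁻¹ * p) (y * z * p)
  have m2 := gp_min p (y * z * p) (z⁻¹ * p) ((y * z)⁻¹ * p)
  have m3 := gp_min p (y * p) (z * p) (z⁻¹ * p)
  have m5 := gp_min p (y⁻¹ * p) (z⁻¹ * p) (z * p)
  have m6 := gp_min p (y * p) (z⁻¹ * p) (y⁻¹ * p)
  have c1 := D_comm (y * p) (y * z * p)
  have c2 := D_comm ((y * z)⁻¹ * p) (y * z * p)
  have c3 := D_comm (z⁻¹ * p) (z * p)
  have c4 := D_comm (y⁻¹ * p) (y * p)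
  unfold gp at *
  omega

/-- A finite set whose pairwise products have small translation length has a point which is
moved only a little by all its members. -/
theorem exists_small_displacement {s : Set (FreeGroup S)} (hs : s.Finite) {T : ℤ} (hT : 1 ≤ T)
    (h : ∀ a ∈ s, ∀ b ∈ s, τ (a * b) ≤ T) : ∃ p, ∀ a ∈ s, D p (a * p) ≤ 10 * T := by
  classical
  have hex : ∃ n : ℕ, ∃ p, ∀ a ∈ s, D p (a * p) ≤ n := by
    obtain ⟨M, hM⟩ := (hs.image fun a => D 1 (a * 1)).bddAbove
    refine ⟨M.toNat, 1, fun a ha => ?_⟩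
    have := hM ⟨a, ha, rfl⟩
    simp only at this
    exact this.trans (Int.self_le_toNat M)
  set n := Nat.find hex with hn
  obtain ⟨p, hp⟩ := Nat.find_spec hex
  rw [← hn] at hp
  by_cases hnT : (n : ℤ) ≤ 10 * T
  · exact ⟨p, fun a ha => (hp a ha).trans hnT⟩
  exfalso
  obtain ⟨k, hk, hkn⟩ : ∃ k ∈ s, D p (k * p) = n := by
    by_contra! hcon
    have := Nat.find_min hex (m := n - 1) (by omega)
    refine this ⟨p, fun a ha => ?_⟩
    have h1 := hp a ha
    have h2 := hcon a ha
    omega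
  obtain ⟨q, q1, q2⟩ := exists_between p (k * p) (k := 1) (by omega) (by omega)
  refine Nat.find_min hex (m := n - 1) (by omega) ⟨q, fun a ha => ?_⟩
  have h1 := hp a ha
  by_cases hlarge : 5 * T < D p (a * p)
  · obtain ⟨g1, g2⟩ := gp_pos_of_τ_mul_le hT (h k hk k hk) (h a ha a ha) (h k hk a ha)
      (by omega) hlarge
    have m1 := gp_min p q (a * p) (k * p)
    have m2 := gp_min p q (a⁻¹ * p) (k * p)
    have e1 : D p (a⁻¹ * p) = D p (a * p) := D_inv_self _ _
    have e2 : D q (a⁻¹ * p) = D (a * q) p := D_inv_right _ _ _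
    have e3 : D (a * q) (a * p) = D q p := D_mul_left _ _ _
    have c1 := D_comm p q
    have c2 := D_comm p (a * q)
    have t1 := D_triangle p q (a * p)
    have t2 := D_triangle p (a * q) (a * p)
    have := D_of_mem (a := p) (b := a * p) (x := q) (y := a * q)
      (by unfold gp at *; omega) (by unfold gp at *; omega)
    rw [abs_of_nonpos (by unfold gp at *; omega)] at this
    unfold gp at *
    omega
  · have := D_displace q p a
    have c1 := D_comm p q
    omega

end

/-- The displacement of a point by the value of a word is linearly bounded by the displacement
by the values of the letters. -/
theorem exists_displacement_bound {n : ℕ} (w : FreeGroup (Fin n)) : ∃ C : ℤ, 0 ≤ C ∧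
    ∀ (S : Type) (A : Fin n → FreeGroup S) (p : FreeGroup S) (M : ℤ), 0 ≤ M →
      (∀ k, D p (A k * p) ≤ M) → D p (lift A w * p) ≤ C * M := by
  induction w using FreeGroup.induction_on with
  | C1 => exact ⟨0, le_rfl, fun S A p M _ _ => by simp [D_self]⟩
  | of k => exact ⟨1, zero_le_one, fun S A p M _ h => by simpa using h k⟩
  | inv_of k ih =>
    obtain ⟨C, hC, h⟩ := ih
    refine ⟨C, hC, fun S A p M hM hA => ?_⟩
    have := h S A p M hM hA
    rwa [_root_.map_inv, D_inv_self]
  | mul x y hx hy =>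
    obtain ⟨C, hC, h⟩ := hx
    obtain ⟨C', hC', h'⟩ := hy
    refine ⟨C + C', by omega, fun S A p M hM hA => ?_⟩
    have h1 := h S A p M hM hA
    have h2 := h' S A p M hM hA
    have h3 := D_mul_mul_le p (lift A x) (lift A y)
    rw [_root_.map_mul, add_mul]
    omega

/-- All letters move some point of the axis of the value of `w` by at most `K` times the
translation length of this value. -/
def Controls {n : ℕ} (K : ℤ) (w : FreeGroup (Fin n)) : Prop :=
  ∀ (S : Type) (A : Fin n → FreeGroup S), lift A w ≠ 1 →
    ∃ p, D p (lift A w * p) = τ (lift A w) ∧ ∀ k, D p (A k * p) ≤ K * τ (lift A w)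

theorem exists_controls {n : ℕ} {K : ℤ} (hK : 0 ≤ K) {w : FreeGroup (Fin n)}
    (h : ∀ (S : Type) (A : Fin n → FreeGroup S), lift A w ≠ 1 →
      ∃ p, ∀ k, D p (A k * p) ≤ K * τ (lift A w)) : ∃ K', 0 ≤ K' ∧ Controls K' w := by
  obtain ⟨C, hC, hw⟩ := exists_displacement_bound w
  refine ⟨K + C * K, by positivity, fun S A hA => ?_⟩
  obtain ⟨p, hp⟩ := h S A hA
  have h0 := τ_nonneg (lift A w)
  obtain ⟨q, q1, q2⟩ := exists_axis p (lift A w)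
  refine ⟨q, q1, fun k => ?_⟩
  have h1 := hw S A p _ (mul_nonneg hK h0) hp
  have h2 := D_displace q p (A k)
  have h3 := hp k
  have h4 := D_comm p q
  have h5 : (K + C * K) * τ (lift A w) = K * τ (lift A w) + C * (K * τ (lift A w)) := by ring
  omega

/-- A word controlling the letters and vanishing on commuting tuples. -/
def IsDetector {n : ℕ} (w : FreeGroup (Fin n)) : Prop :=
  (∃ K, 0 ≤ K ∧ Controls K w) ∧
    ∀ (S : Type) (A : Fin n → FreeGroup S), (∀ i j, Commute (A i) (A j)) → lift A w = 1

theorem isDetector_one {n : ℕ} : IsDetector (1 : FreeGroup (Fin n)) :=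
  ⟨⟨0, le_rfl, fun _ _ h => absurd (_root_.map_one _) h⟩, fun _ _ _ => _root_.map_one _⟩

theorem IsDetector.exists_or {n : ℕ} {e z : FreeGroup (Fin n)} (he : IsDetector e)
    (hz : IsDetector z) : ∃ w, IsDetector w ∧
      ∀ (S : Type) (A : Fin n → FreeGroup S), lift A e ≠ 1 ∨ lift A z ≠ 1 → lift A w ≠ 1 := by
  obtain ⟨⟨K, hK, hKe⟩, he1⟩ := he
  obtain ⟨⟨K', hK', hKz⟩, hz1⟩ := hz
  obtain ⟨C, hC, hCz⟩ := exists_displacement_bound z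
  obtain ⟨M, hM⟩ : ∃ M : ℕ, (M : ℤ) = 53 * (C * K) + 13 :=
    ⟨(53 * (C * K) + 13).toNat, Int.toNat_of_nonneg (by positivity)⟩
  have key : ∀ (S : Type) (A : Fin n → FreeGroup S), lift A e ≠ 1 →
      τ (lift A e) ≤ τ (lift A (e ^ M * z)) ∧ ∃ p, ∀ k, D p (A k * p) ≤ K * τ (lift A e) := by
    intro S A hA
    obtain ⟨p, p1, p2⟩ := hKe S A hA
    have h0 := τ_nonneg (lift A e)
    have h1 := hCz S A p _ (mul_nonneg hK h0) p2
    have h2 := τ_pow_mul_ge hA p1 (K := C * K) (R := lift A z) (by positivity)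
      (by rw [mul_assoc]; exact h1) M
    rw [hM] at h2
    rw [_root_.map_mul, _root_.map_pow]
    refine ⟨?_, p, p2⟩
    linarith
  refine ⟨e ^ M * z, ⟨?_, fun S A h => by simp [he1 S A h, hz1 S A h]⟩, fun S A h h1 => ?_⟩
  · refine exists_controls (K := max K K') (le_max_of_le_left hK) fun S A hA => ?_
    by_cases h : lift A e = 1
    · have e1 : lift A (e ^ M * z) = lift A z := by simp [h]
      rw [e1] at hA ⊢
      obtain ⟨p, -, hp⟩ := hKz S A hA
      exact ⟨p, fun k => (hp k).trans
        (mul_le_mul_of_nonneg_right (le_max_right _ _) (τ_nonneg _))⟩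
    · obtain ⟨h1, p, hp⟩ := key S A h
      exact ⟨p, fun k => (hp k).trans
        (mul_le_mul (le_max_left _ _) h1 (τ_nonneg _) (le_max_of_le_left hK))⟩
  · by_cases he : lift A e = 1
    · have e1 : lift A (e ^ M * z) = lift A z := by simp [he]
      rw [e1] at h1
      tauto
    · have h2 := (key S A he).1
      rw [h1, τ_one] at h2
      have := τ_pos he
      omega

theorem exists_detector_or {n : ℕ} (E : List (FreeGroup (Fin n))) (hE : ∀ e ∈ E, IsDetector e) :
    ∃ w, IsDetector w ∧ ∀ (S : Type) (A : Fin n → FreeGroup S),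
      (∃ e ∈ E, lift A e ≠ 1) → lift A w ≠ 1 := by
  induction E with
  | nil => exact ⟨1, isDetector_one, fun S A ⟨e, he, _⟩ => by simp at he⟩
  | cons e E ih =>
    obtain ⟨z, hz, hz'⟩ := ih fun e he => hE e (List.mem_cons_of_mem _ he)
    obtain ⟨w, hw, hw'⟩ := (hE e List.mem_cons_self).exists_or hz
    refine ⟨w, hw, fun S A ⟨f, hf, hf'⟩ => hw' S A ?_⟩
    rcases List.mem_cons.1 hf with rfl | hf
    · exact Or.inl hf'
    · exact Or.inr (hz' S A ⟨f, hf, hf'⟩)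

/-- Finitely many words dominating, in translation length, a list of given words. -/
theorem exists_dominating {n : ℕ} (i j : Fin n) (L : List (FreeGroup (Fin n))) :
    ∃ E : List (FreeGroup (Fin n)), ∀ (S : Type) (A : Fin n → FreeGroup S),
      (∀ e ∈ E, lift A e ≠ 1 → ¬ Commute (A i) (A j) ∧
        ∀ y ∈ L, τ (lift A y) ≤ τ (lift A e)) ∧
      (¬ Commute (A i) (A j) → (∀ y ∈ L, lift A y ≠ 1) → ∃ e ∈ E, lift A e ≠ 1) := by
  induction L with
  | nil =>
    refine ⟨[powComm (of i) (of j)], fun S A => ⟨fun e he h => ⟨fun hc => ?_, by simp⟩,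
      fun hc _ => ⟨_, List.mem_singleton_self _, ?_⟩⟩⟩
    · rw [List.mem_singleton.1 he, map_powComm, lift_apply_of, lift_apply_of] at h
      exact h (powComm_eq_one hc)
    · rw [map_powComm, lift_apply_of, lift_apply_of]
      exact powComm_ne_one hc
  | cons y L ih =>
    obtain ⟨E, hE⟩ := ih
    refine ⟨E.flatMap fun e => [powComm e y, powComm e (of i * y * (of i)⁻¹),
      powComm e (of j * y * (of j)⁻¹)], fun S A => ⟨fun f hf h => ?_, fun hc hL => ?_⟩⟩
    · obtain ⟨e, he, hf⟩ := List.mem_flatMap.1 hf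
      have hv : ∃ v, τ (lift A v) = τ (lift A y) ∧ f = powComm e v := by
        simp only [List.mem_cons, List.not_mem_nil, or_false] at hf
        rcases hf with rfl | rfl | rfl
        · exact ⟨y, rfl, rfl⟩
        · exact ⟨_, by simp [τ_conj], rfl⟩
        · exact ⟨_, by simp [τ_conj], rfl⟩
      obtain ⟨v, hv, rfl⟩ := hv
      rw [map_powComm] at h ⊢
      have hcom : ¬ Commute (lift A e) (lift A v) := fun h' => h (powComm_eq_one h')
      have he1 : lift A e ≠ 1 := by
        intro h1
        rw [h1] at hcom
        exact hcom (Commute.one_left _)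
      obtain ⟨h2, h3⟩ := (hE S A).1 e he he1
      have h4 := τ_powComm_ge hcom
      have h5 := τ_powComm_ge' hcom
      refine ⟨h2, fun x hx => ?_⟩
      rcases List.mem_cons.1 hx with rfl | hx
      · omega
      · exact (h3 x hx).trans h4
    · obtain ⟨e, he, he1⟩ := (hE S A).2 hc fun y hy => hL y (List.mem_cons_of_mem _ hy)
      have hy := hL y List.mem_cons_self
      by_contra! hall
      have hall' : ∀ v ∈ [y, of i * y * (of i)⁻¹, of j * y * (of j)⁻¹],
          Commute (lift A e) (lift A v) := by
        intro v hv
        by_contra hcom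
        refine powComm_ne_one hcom ?_
        rw [← map_powComm]
        refine hall _ (List.mem_flatMap.2 ⟨e, he, ?_⟩)
        simp only [List.mem_cons, List.not_mem_nil, or_false] at hv ⊢
        rcases hv with rfl | rfl | rfl <;> simp
      have h1 := hall' y (by simp)
      have h2 := hall' (of i * y * (of i)⁻¹) (by simp)
      have h3 := hall' (of j * y * (of j)⁻¹) (by simp)
      simp only [_root_.map_mul, _root_.map_inv, lift_apply_of] at h2 h3
      have h4 := commute_of_conj hy (commute_trans he1 h2.symm h1)
      have h5 := commute_of_conj hy (commute_trans he1 h3.symm h1)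
      exact hc (commute_trans hy h4 h5.symm)

theorem exists_detector_pair {n : ℕ} (i j : Fin n) :
    ∃ w : FreeGroup (Fin n), IsDetector w ∧ ∀ (S : Type) (A : Fin n → FreeGroup S),
      ¬ Commute (A i) (A j) → lift A w ≠ 1 := by
  obtain ⟨z, hz⟩ : ∃ z : FreeGroup (Fin n), z = powComm (of i) (of j) := ⟨_, rfl⟩
  set T : List (FreeGroup (Fin n)) := [1, of i, of j]
  set G : List (FreeGroup (Fin n)) :=
    T ++ T.flatMap fun s => (List.finRange n).map fun k => of k * s with hG
  set L : List (FreeGroup (Fin n)) :=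
    G.flatMap fun g => G.map fun h => (g * z * g⁻¹) * (h * z * h⁻¹) with hL
  obtain ⟨E, hE⟩ := exists_dominating i j L
  have hzA : ∀ (S : Type) (A : Fin n → FreeGroup S), lift A z = powComm (A i) (A j) := by
    intro S A
    rw [hz, map_powComm, lift_apply_of, lift_apply_of]
  suffices hEd : ∀ e ∈ E, IsDetector e by
    obtain ⟨w, hw, hw'⟩ := exists_detector_or E hEd
    refine ⟨w, hw, fun S A hA => hw' S A ((hE S A).2 hA fun y hy hy1 => ?_)⟩
    simp only [hL, List.mem_flatMap, List.mem_map] at hy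
    obtain ⟨g, -, h, -, rfl⟩ := hy
    simp only [_root_.map_mul, _root_.map_inv] at hy1
    refine conj_ne_inv (u := lift A z) (by rw [hzA]; exact powComm_ne_one hA)
      (R := (lift A h)⁻¹ * lift A g) ?_
    rw [eq_inv_iff_mul_eq_one]
    have := congrArg (fun x => (lift A h)⁻¹ * x * lift A h) hy1
    simpa [mul_assoc] using this
  intro e he
  refine ⟨exists_controls (K := 41) (by norm_num) fun S A hA => ?_, fun S A hA => ?_⟩
  · obtain ⟨hc, hdom⟩ := (hE S A).1 e he hA
    have hT := τ_pos hA
    have hu : lift A z ≠ 1 := by rw [hzA]; exact powComm_ne_one hc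
    obtain ⟨p, hp⟩ := exists_small_displacement
      (s := {x | ∃ g ∈ G, x = lift A g * lift A z * (lift A g)⁻¹})
      (((List.finite_toSet G).image fun g => lift A g * lift A z * (lift A g)⁻¹).subset
        (by rintro x ⟨g, hg, rfl⟩; exact ⟨g, hg, rfl⟩)) hT
      (by
        rintro _ ⟨g, hg, rfl⟩ _ ⟨h, hh, rfl⟩
        have := hdom ((g * z * g⁻¹) * (h * z * h⁻¹))
          (List.mem_flatMap.2 ⟨g, hg, List.mem_map.2 ⟨h, hh, rfl⟩⟩)
        simpa only [_root_.map_mul, _root_.map_inv] using this)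
    have hp' : ∀ g ∈ G, D p (lift A g * lift A z * (lift A g)⁻¹ * p) ≤ 10 * τ (lift A e) :=
      fun g hg => hp _ ⟨g, hg, rfl⟩
    obtain ⟨s, hs, hsz⟩ : ∃ s ∈ T, ¬ Commute (lift A s) (lift A z) := by
      by_contra! hall
      have h1 := hall (of i) (by simp [T])
      have h2 := hall (of j) (by simp [T])
      rw [lift_apply_of] at h1 h2
      exact hc (commute_trans hu h1 h2.symm)
    refine ⟨p, fun k => ?_⟩
    have q : ∀ s ∈ T, D p (lift A s * lift A z * (lift A s)⁻¹ * p) ≤ 10 * τ (lift A e) ∧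
        D ((A k)⁻¹ * p) (lift A s * lift A z * (lift A s)⁻¹ * ((A k)⁻¹ * p)) ≤
          10 * τ (lift A e) := by
      intro s hs
      refine ⟨hp' s (List.mem_append_left _ hs), ?_⟩
      have h1 := hp' (of k * s) (List.mem_append_right _ (List.mem_flatMap.2
        ⟨s, hs, List.mem_map.2 ⟨k, List.mem_finRange k, rfl⟩⟩))
      rw [D_inv_left]
      simpa [mul_assoc] using h1
    by_contra! hbig
    obtain ⟨q1, q2⟩ := q 1 (by simp [T])
    obtain ⟨q3, q4⟩ := q s hs
    simp only [_root_.map_one, one_mul, inv_one, mul_one] at q1 q2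
    have h4 : D p ((A k)⁻¹ * p) = D p (A k * p) := D_inv_self _ _
    have h5 := commute_of_displace (R := 10 * τ (lift A e)) q3 q4 q1 q2 (by omega)
    exact hsz (commute_of_conj hu h5)
  · by_contra h1
    exact ((hE S A).1 e he h1).1 (hA i j)

theorem exists_detector (n : ℕ) :
    ∃ w : FreeGroup (Fin n), IsDetector w ∧ ∀ (S : Type) (A : Fin n → FreeGroup S),
      lift A w = 1 → ∀ i j, Commute (A i) (A j) := by
  choose w hw hw' using fun p : Fin n × Fin n => exists_detector_pair p.1 p.2
  obtain ⟨v, hv, hv'⟩ := exists_detector_or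
    (((List.finRange n).product (List.finRange n)).map w) (by
      intro e he
      obtain ⟨p, -, rfl⟩ := List.mem_map.1 he
      exact hw p)
  refine ⟨v, hv, fun S A h i j => ?_⟩
  by_contra hc
  exact hv' S A ⟨w (i, j), List.mem_map.2 ⟨(i, j), by simp, rfl⟩, hw' (i, j) S A hc⟩ h

variable {S : Type}

/-- A bound, linear in `K`, for the displacement by all words of a list. -/
theorem exists_bound {n : ℕ} (w : FreeGroup (Fin n)) {K : ℤ} (hK : 0 ≤ K) :
    ∃ C : ℤ, 0 ≤ C ∧ ∀ (S : Type) (A : Fin n → FreeGroup S) (p : FreeGroup S) (l : ℤ), 0 ≤ l →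
      (∀ k, D p (A k * p) ≤ K * l) → D p (lift A w * p) ≤ C * l := by
  obtain ⟨C, hC, h⟩ := exists_displacement_bound w
  refine ⟨C * K, by positivity, fun S A p l hl hA => ?_⟩
  rw [mul_assoc]
  exact h S A p _ (by positivity) hA

theorem exists_tail_commute {n : ℕ} (u : FreeGroup (Fin n)) {K : ℤ} (hK : 0 ≤ K)
    (hu : Controls K u) (l : List (FreeGroup (Fin n))) :
    ∃ R : FreeGroup (Fin n),
      (∀ (S : Type) (A : Fin n → FreeGroup S), lift A u = 1 →
        lift A R = (l.map (lift A)).prod) ∧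
      ∀ (S : Type) (A : Fin n → FreeGroup S), lift A u ≠ 1 → Commute (lift A R) (lift A u) →
        ∀ g ∈ l, Commute (lift A g) (lift A u) := by
  induction l with
  | nil => exact ⟨1, fun S A _ => by simp, fun S A _ _ => by simp⟩
  | cons g l ih =>
    obtain ⟨R, hR1, hR2⟩ := ih
    obtain ⟨C, hC, hCg⟩ := exists_bound g hK
    obtain ⟨C', hC', hCR⟩ := exists_bound R hK
    obtain ⟨N, hN⟩ := Int.eq_ofNat_of_zero_le (show 0 ≤ 8 * (C + C') + 6 by omega)
    refine ⟨g * u ^ N * R, fun S A hA => by simp [hA, hR1 S A hA], fun S A hA hc => ?_⟩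
    obtain ⟨p, p1, p2⟩ := hu S A hA
    have hl := τ_nonneg (lift A u)
    have h1 := hCg S A p _ hl p2
    have h2 := hCR S A p _ hl p2
    have h3 : C * τ (lift A u) ≤ (C + C') * τ (lift A u) := by gcongr; omega
    have h4 : C' * τ (lift A u) ≤ (C + C') * τ (lift A u) := by gcongr; omega
    have e : lift A (g * u ^ N * R) = lift A g * lift A u ^ N * lift A R := by simp
    have hg : Commute (lift A g) (lift A u) :=
      commute_left_of_commute hA p1 (K := C + C') (by omega) (by omega) (by omega) hN.le e hc
    have hR : Commute (lift A R) (lift A u) := by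
      have : lift A R = (lift A g * lift A u ^ N)⁻¹ * lift A (g * u ^ N * R) := by
        rw [e]; group
      rw [this]
      exact ((hg.mul_left ((Commute.refl _).pow_left N)).inv_left).mul_left hc
    intro x hx
    rcases List.mem_cons.1 hx with rfl | hx
    · exact hg
    · exact hR2 S A hA hR x hx

/-- The list of the words `x_k, t, x_k⁻¹, t`. -/
def letters {n : ℕ} (t : FreeGroup (Fin n)) : List (FreeGroup (Fin n)) :=
  (List.finRange n).flatMap fun k => [of k, t, (of k)⁻¹, t]

theorem prod_letters {n : ℕ} {S : Type} {t : FreeGroup (Fin n)} {A : Fin n → FreeGroup S}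
    (h : lift A t = 1) : ((letters t).map (lift A)).prod = 1 := by
  unfold letters
  induction List.finRange n with
  | nil => simp
  | cons k l ih => simp [h, ih]

theorem of_mem_letters {n : ℕ} (t : FreeGroup (Fin n)) (k : Fin n) : of k ∈ letters t :=
  List.mem_flatMap.2 ⟨k, List.mem_finRange k, by simp⟩

theorem exists_base (n : ℕ) : ∃ (t u : FreeGroup (Fin n)) (K : ℤ), 0 ≤ K ∧ Controls K u ∧
    (∀ (S : Type) (A : Fin n → FreeGroup S), (∀ i j, Commute (A i) (A j)) →
      lift A t = 1 ∧ lift A u = 1) ∧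
    ∀ (S : Type) (A : Fin n → FreeGroup S), ¬ (∀ i j, Commute (A i) (A j)) →
      lift A u ≠ 1 ∧ ¬ IsProperPower (lift A u) ∧ ¬ Commute (lift A t) (lift A u) := by
  obtain ⟨t, ⟨⟨K, hK, ht⟩, ht1⟩, ht2⟩ := exists_detector n
  obtain ⟨R, hR1, hR2⟩ := exists_tail_commute t hK ht (letters t)
  obtain ⟨C, hC, hCR⟩ := exists_bound R hK
  obtain ⟨N, hN⟩ := Int.eq_ofNat_of_zero_le (show 0 ≤ 30 * (51 * C + 12) by omega)
  have hcomm : ∀ (S : Type) (A : Fin n → FreeGroup S), (∀ i j, Commute (A i) (A j)) →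
      lift A t = 1 ∧ lift A (t ^ N * R) = 1 := by
    intro S A hA
    have h1 := ht1 S A hA
    refine ⟨h1, ?_⟩
    simp [h1, hR1 S A h1, prod_letters h1]
  have hRt : ∀ (S : Type) (A : Fin n → FreeGroup S), lift A t ≠ 1 →
      ¬ Commute (lift A R) (lift A t) := by
    intro S A hA hc
    have h1 : ∀ k, Commute (A k) (lift A t) := fun k => by
      simpa using hR2 S A hA hc _ (of_mem_letters t k)
    exact hA (ht1 S A fun i j => commute_trans hA (h1 i) (h1 j).symm)
  have key : ∀ (S : Type) (A : Fin n → FreeGroup S), lift A t ≠ 1 →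
      τ (lift A t) ≤ τ (lift A (t ^ N * R)) ∧ ∃ p, D p (lift A t * p) = τ (lift A t) ∧
        (∀ k, D p (A k * p) ≤ K * τ (lift A t)) ∧ D p (lift A R * p) ≤ C * τ (lift A t) := by
    intro S A hA
    obtain ⟨p, p1, p2⟩ := ht S A hA
    have hl := τ_nonneg (lift A t)
    have h1 := hCR S A p _ hl p2
    refine ⟨?_, p, p1, p2, h1⟩
    have h2 := τ_pow_mul_ge hA p1 hC h1 N
    have h3 : 1 * τ (lift A t) ≤ (N - (53 * C + 12)) * τ (lift A t) := by
      gcongr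
      have : (N : ℤ) = 30 * (51 * C + 12) := hN.symm
      omega
    rw [_root_.map_mul, _root_.map_pow]
    linarith
  obtain ⟨K', hK', hu⟩ := exists_controls (w := t ^ N * R) hK fun S A hA => by
    have h1 : lift A t ≠ 1 := by
      intro h1
      exact hA (hcomm S A (ht2 S A h1)).2
    obtain ⟨h2, p, -, p2, -⟩ := key S A h1
    exact ⟨p, fun k => (p2 k).trans (by gcongr)⟩
  refine ⟨t, t ^ N * R, K', hK', hu, hcomm, fun S A hA => ?_⟩
  have h1 : lift A t ≠ 1 := fun h1 => hA (ht2 S A h1)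
  obtain ⟨h2, p, p1, p2, p3⟩ := key S A h1
  refine ⟨fun h3 => ?_, ?_, fun h3 => ?_⟩
  · rw [h3, τ_one] at h2
    have := τ_pos h1
    omega
  · rintro ⟨v, k, hk, hv⟩
    rw [_root_.map_mul, _root_.map_pow] at hv
    exact hRt S A h1 (commute_of_pow_eq h1 p1 hC p3 hN.le hk hv)
  · apply hRt S A h1
    have : lift A R = (lift A t ^ N)⁻¹ * lift A (t ^ N * R) := by simp
    rw [this]
    exact (((Commute.refl _).pow_left N).inv_left).mul_left h3.symm

theorem exists_shift {u p g h R R' : FreeGroup S} {K L J i j : ℤ} {N : ℕ} (hu : u ≠ 1)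
    (hu' : ¬ IsProperPower u) (hp : D p (u * p) = τ u) (hK : 0 ≤ K) (hL : 0 ≤ L)
    (hg : D p (g * p) ≤ K * τ u)
    (hh : D p (h * p) ≤ K * τ u) (hR : D p (R * p) ≤ L * τ u) (hR' : D p (R' * p) ≤ L * τ u)
    (hi : |i| ≤ J) (hj : |j| ≤ J) (hN : 16 * (K + L + J) + 6 ≤ N)
    (heq : g * u ^ N * R * u ^ i = u ^ j * (h * u ^ N * R')) :
    ∃ m : ℤ, |m| ≤ 2 * K + J ∧ g * u ^ m = u ^ j * h ∧ R * u ^ i = u ^ m * R' := by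
  have hl := τ_pos hu
  have hJ : 0 ≤ J := (abs_nonneg i).trans hi
  have hz : ∀ m : ℤ, |m| ≤ J → D p (u ^ m * p) ≤ J * τ u := by
    intro m hm
    rw [D_zpow_axis hp]
    gcongr
  have h1 := hz i hi
  have h2 := hz j hj
  have b1 := D_mul_mul_le p R (u ^ i)
  have b2 := D_mul_mul_le p (u ^ j) h
  have hKl : 0 ≤ K * τ u := by positivity
  have hLl : 0 ≤ L * τ u := by positivity
  have hJl : 0 ≤ J * τ u := by positivity
  have e : (K + L + J) * τ u = K * τ u + L * τ u + J * τ u := by ring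
  have hc := commute_of_mul_pow_eq (g := g) (h := u ^ j * h) (R := R * u ^ i) (R' := R')
    (K := K + L + J) hu hp (by omega) (by omega) (by omega) (by omega) hN
    (by simpa only [mul_assoc] using heq)
  obtain ⟨m, hm⟩ := exists_zpow_of_commute hu hu' hc
  have hm' : g * u ^ m = u ^ j * h := by rw [← hm]; group
  refine ⟨m, ?_, hm', ?_⟩
  · have b3 := D_mul_mul_le p g⁻¹ (u ^ j * h)
    rw [hm, D_zpow_axis hp, D_inv_self] at b3
    have : |m| * τ u ≤ (2 * K + J) * τ u := by linarith
    exact le_of_mul_le_mul_right this (by omega)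
  · have h3 : u ^ m * u ^ N = u ^ N * u ^ m := (((Commute.refl u).zpow_left m).pow_right N).eq
    have h4 : g * u ^ N * (R * u ^ i) = g * u ^ N * (u ^ m * R') := by
      calc _ = u ^ j * (h * u ^ N * R') := by rw [← heq]; simp only [mul_assoc]
        _ = (u ^ j * h) * u ^ N * R' := by simp only [mul_assoc]
        _ = g * (u ^ m * u ^ N) * R' := by rw [← hm']; simp only [mul_assoc]
        _ = _ := by rw [h3]; simp only [mul_assoc]
    exact mul_left_cancel h4

/-- The values of the words of the list at `A` and `B` agree up to a chain of powers of `u`. -/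
def Shifts {n : ℕ} (u : FreeGroup S) (A B : Fin n → FreeGroup S) :
    ℤ → List (FreeGroup (Fin n)) → Prop
  | _, [] => True
  | j, g :: l => ∃ m : ℤ, lift A g * u ^ m = u ^ j * lift B g ∧ Shifts u A B m l

theorem exists_tail_shifts {n : ℕ} (u : FreeGroup (Fin n)) {K : ℤ} (hK : 0 ≤ K)
    (l : List (FreeGroup (Fin n))) : ∀ J : ℤ, 0 ≤ J → ∃ R : FreeGroup (Fin n),
      (∀ (S : Type) (A : Fin n → FreeGroup S), lift A u = 1 →
        lift A R = (l.map (lift A)).prod) ∧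
      ∀ (S : Type) (A B : Fin n → FreeGroup S) (v p : FreeGroup S) (i j : ℤ), lift A u = v →
        lift B u = v → v ≠ 1 → ¬ IsProperPower v → D p (v * p) = τ v →
        (∀ k, D p (A k * p) ≤ K * τ v) → (∀ k, D p (B k * p) ≤ K * τ v) → |i| ≤ J → |j| ≤ J →
        lift A R * v ^ i = v ^ j * lift B R → Shifts v A B j l := by
  induction l with
  | nil => exact fun J _ => ⟨1, fun S A _ => by simp, fun S A B v p i j _ _ _ _ _ _ _ _ _ _ =>
      trivial⟩
  | cons g l ih =>
    intro J hJ
    obtain ⟨C, hC, hCg⟩ := exists_bound g hK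
    obtain ⟨R, hR1, hR2⟩ := ih (2 * C + J) (by omega)
    obtain ⟨C', hC', hCR⟩ := exists_bound R hK
    obtain ⟨N, hN⟩ := Int.eq_ofNat_of_zero_le (show 0 ≤ 16 * (C + C' + J) + 6 by omega)
    refine ⟨g * u ^ N * R, fun S A hA => by simp [hA, hR1 S A hA], ?_⟩
    intro S A B v p i j hA hB hv hv' hp hAp hBp hi hj heq
    have hl := τ_nonneg v
    obtain ⟨m, hm, hgm, hRm⟩ := exists_shift hv hv' hp hC hC' (hCg S A p _ hl hAp)
      (hCg S B p _ hl hBp) (hCR S A p _ hl hAp) (hCR S B p _ hl hBp) hi hj hN.le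
      (by simpa only [_root_.map_mul, _root_.map_pow, hA, hB] using heq)
    exact ⟨m, hgm, hR2 S A B v p i m hA hB hv hv' hp hAp hBp (by omega) hm hRm⟩

theorem shift_eq_of_not_commute {t t' u : FreeGroup S} (htu : ¬ Commute t u) {c j m : ℤ}
    (hc : t * u ^ c = u ^ c * t') (h : t * u ^ m = u ^ j * t') : j = c ∧ m = c := by
  have hu : u ≠ 1 := by rintro rfl; exact htu (Commute.one_right t)
  have h1 : t' = u ^ (-c) * t * u ^ c := by
    rw [mul_assoc, hc]; group
  have h2 : t⁻¹ * u ^ (j - c) * t = u ^ (m - c) := by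
    rw [h1] at h
    have h3 : u ^ m = t⁻¹ * (u ^ j * (u ^ (-c) * t * u ^ c)) := by rw [← h]; group
    rw [zpow_sub u m c, h3]
    group
  have h4 := conj_zpow_eq_zero htu h2
  rw [h4, zpow_zero, mul_one, inv_mul_cancel] at h2
  have h5 := zpow_eq_zero hu h2.symm
  omega

theorem Shifts.letters_eq {n : ℕ} {u : FreeGroup S} {t : FreeGroup (Fin n)}
    {A B : Fin n → FreeGroup S} (htu : ¬ Commute (lift A t) u) {c : ℤ}
    (hc : lift A t * u ^ c = u ^ c * lift B t) (h : Shifts u A B c (letters t)) (k : Fin n) :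
    A k * u ^ c = u ^ c * B k := by
  have key : ∀ l : List (Fin n),
      Shifts u A B c (l.flatMap fun k => [of k, t, (of k)⁻¹, t]) → ∀ k ∈ l,
        A k * u ^ c = u ^ c * B k := by
    intro l
    induction l with
    | nil => simp
    | cons a l ih =>
      rintro ⟨m1, h1, m2, h2, m3, h3, m4, h4, hl⟩
      obtain ⟨rfl, rfl⟩ := shift_eq_of_not_commute htu hc h2
      obtain ⟨rfl, rfl⟩ := shift_eq_of_not_commute htu hc h4
      intro k hk
      rcases List.mem_cons.1 hk with rfl | hk
      · simpa using h1
      · exact ih hl k hk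
  exact key _ h k (List.mem_finRange k)

theorem lift_conj {n : ℕ} (A : Fin n → FreeGroup S) (s : FreeGroup S) (w : FreeGroup (Fin n)) :
    lift (fun k => s * A k * s⁻¹) w = s * lift A w * s⁻¹ := by
  have : lift (fun k => s * A k * s⁻¹) = (MulAut.conj s).toMonoidHom.comp (lift A) := by
    ext k
    simp
  rw [this]
  simp

theorem eq_or_eq_inv_of_commute {u v : FreeGroup S} (hu : u ≠ 1) (hu' : ¬ IsProperPower u)
    (hv : ¬ IsProperPower v) (hv1 : v ≠ 1) (h : Commute u v) : v = u ∨ v = u⁻¹ := by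
  obtain ⟨a, rfl⟩ := exists_zpow_of_commute hu hu' h.symm
  obtain ⟨b, hb⟩ := exists_zpow_of_commute hv1 hv h
  have h1 : a * b = 1 := by
    refine zpow_inj hu ?_
    rw [zpow_mul, ← hb, zpow_one]
  rcases Int.eq_one_or_neg_one_of_mul_eq_one h1 with rfl | rfl <;> simp

/-- Two tuples on which the words `u` and `t * u ^ N * R` agree are equal. -/
theorem eq_of_lift_eq {n N : ℕ} {t u R : FreeGroup (Fin n)} {K C L J : ℤ}
    (hu : Controls K u) (hC : 0 ≤ C) (hL : 0 ≤ L) (hJ : J = 16 * C + 13)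
    (ht : ∀ (S : Type) (A : Fin n → FreeGroup S) (p : FreeGroup S) (l : ℤ), 0 ≤ l →
      (∀ k, D p (A k * p) ≤ (K + 2) * l) → D p (lift A t * p) ≤ C * l)
    (hR : ∀ (S : Type) (A : Fin n → FreeGroup S) (p : FreeGroup S) (l : ℤ), 0 ≤ l →
      (∀ k, D p (A k * p) ≤ (K + 2) * l) → D p (lift A R * p) ≤ L * l)
    (hShift : ∀ (S : Type) (A B : Fin n → FreeGroup S) (v p : FreeGroup S) (i j : ℤ),
        lift A u = v → lift B u = v → v ≠ 1 → ¬ IsProperPower v → D p (v * p) = τ v →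
        (∀ k, D p (A k * p) ≤ (K + 2) * τ v) → (∀ k, D p (B k * p) ≤ (K + 2) * τ v) →
        |i| ≤ 2 * C + J → |j| ≤ 2 * C + J →
        lift A R * v ^ i = v ^ j * lift B R → Shifts v A B j (t :: letters t))
    (hN : 40 * C + 16 * L + 16 * J + 30 ≤ N)
    {A B : Fin n → FreeGroup S} {v : FreeGroup S} (hA : lift A u = v) (hB : lift B u = v)
    (hv : v ≠ 1) (hv' : ¬ IsProperPower v) (hAt : ¬ Commute (lift A t) v)
    (hBt : ¬ Commute (lift B t) v)
    (hAB : lift A (t * u ^ N * R) = lift B (t * u ^ N * R)) :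
    A = B := by
  have hl := τ_pos hv
  obtain ⟨p, p1, p2⟩ := hu S A (by rwa [hA])
  obtain ⟨p', p1', p2'⟩ := hu S B (by rwa [hB])
  rw [hA] at p1 p2
  rw [hB] at p1' p2'
  have hK2 : (K + 2) * τ v = K * τ v + 2 * τ v := by ring
  have a1 := ht S A p (τ v) (by omega) fun k => (p2 k).trans (by omega)
  have a2 := ht S B p' (τ v) (by omega) fun k => (p2' k).trans (by omega)
  have a3 := hR S A p (τ v) (by omega) fun k => (p2 k).trans (by omega)
  have a4 := hR S B p' (τ v) (by omega) fun k => (p2' k).trans (by omega)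
  have halign := D_axis_le_of_not_commute (N := N) hv p1 p1' hC a1 a3
    (Q := lift A (t * u ^ N * R)) (by simp [hA]) hAt a2 a4 (by rw [hAB]; simp [hB]) hBt (by omega)
  obtain ⟨i, hi⟩ := exists_between_translates hv p1' p1
  have b1 := D_nonneg p (v * (v ^ i * p'))
  have b2 := D_nonneg (v ^ i * p') p
  have b3 : D p' (v ^ i * p') = |i| * τ v := D_zpow_axis p1' i
  have b4 := D_triangle p' p (v ^ i * p')
  have b5 := D_comm p (v ^ i * p')
  have b6 := D_comm p p'
  have hiJ : |i| ≤ J := by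
    have h1 : (16 * C + 13) * τ v = (16 * C + 12) * τ v + τ v := by ring
    have h2 : |i| * τ v ≤ J * τ v := by rw [hJ]; omega
    exact le_of_mul_le_mul_right h2 (by omega)
  set B' : Fin n → FreeGroup S := fun k => v ^ i * B k * (v ^ i)⁻¹ with hB'
  have hB'w : ∀ w, lift B' w = v ^ i * lift B w * (v ^ i)⁻¹ := lift_conj B (v ^ i)
  have hB'u : lift B' u = v := by
    rw [hB'w, hB, (((Commute.refl v).zpow_left i)).eq, mul_inv_cancel_right]
  have hAp : ∀ k, D p (A k * p) ≤ (K + 2) * τ v := fun k => (p2 k).trans (by omega)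
  have hBp : ∀ k, D p (B' k * p) ≤ (K + 2) * τ v := by
    intro k
    have h1 := D_displace p (v ^ i * p') (B' k)
    have h2 : B' k * (v ^ i * p') = v ^ i * (B k * p') := by rw [hB']; group
    rw [h2, D_mul_left] at h1
    have := p2' k
    omega
  have heq : lift A t * v ^ N * lift A R * v ^ (-i) =
      v ^ (-i) * (lift B' t * v ^ N * lift B' R) := by
    have h1 := hB'w (t * u ^ N * R)
    rw [← hAB] at h1
    simp only [_root_.map_mul, _root_.map_pow, hA, hB'u] at h1
    rw [h1, zpow_neg]
    simp only [mul_assoc, inv_mul_cancel_left]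
  have hJ0 : 0 ≤ J := by omega
  obtain ⟨m, hm, hm1, hm2⟩ := exists_shift (J := J) hv hv' p1 hC hL (ht S A p (τ v) (by omega) hAp)
    (ht S B' p (τ v) (by omega) hBp) (hR S A p (τ v) (by omega) hAp) (hR S B' p (τ v) (by omega) hBp)
    (by rwa [abs_neg]) (by rwa [abs_neg]) (by omega) heq
  obtain ⟨m', hm', hsh⟩ := hShift S A B' v p (-i) m hA hB'u hv hv' p1 hAp hBp
    (by rw [abs_neg]; omega) hm hm2
  have hc : m = -i ∧ m' = m := by
    have h1 : lift B' t = v ^ i * (lift A t * v ^ m) := by rw [hm1]; group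
    have h2 : (lift A t)⁻¹ * v ^ (m + i) * lift A t = v ^ (m' - m) := by
      rw [h1] at hm'
      have h3 : v ^ m' = (lift A t)⁻¹ * (v ^ m * (v ^ i * (lift A t * v ^ m))) := by
        rw [← hm']; group
      rw [zpow_sub, h3, zpow_add]
      group
    have h4 := conj_zpow_eq_zero hAt h2
    rw [h4, zpow_zero, mul_one, inv_mul_cancel] at h2
    have h5 := zpow_eq_zero hv h2.symm
    omega
  obtain ⟨rfl, rfl⟩ := hc
  have hfin := Shifts.letters_eq hAt hm1 hsh
  funext k
  have h1 := hfin k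
  have h3 : v ^ (-i) * B' k = B k * v ^ (-i) := by rw [hB']; group
  rw [h3] at h1
  exact mul_right_cancel h1

theorem exists_word (n : ℕ) : ∃ w : FreeGroup (Fin n),
    (∀ (S : Type) (A : Fin n → FreeGroup S), (∀ i j, Commute (A i) (A j)) → lift A w = 1) ∧
    (∀ (S : Type) (A : Fin n → FreeGroup S), ¬ (∀ i j, Commute (A i) (A j)) →
      lift A w ≠ 1 ∧ ¬ IsProperPower (lift A w)) ∧
    ∀ (S : Type) (A B : Fin n → FreeGroup S), lift A w = lift B w → lift A w ≠ 1 →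
      ∃ s : FreeGroup S, ∀ i, s * A i * s⁻¹ = B i := by
  obtain ⟨t, u, K, hK, hu, hcomm, hncomm⟩ := exists_base n
  have hK2 : 0 ≤ K + 2 := by omega
  obtain ⟨C, hC, ht⟩ := exists_bound t hK2
  obtain ⟨R, hR1, hShift⟩ := exists_tail_shifts u hK2 (t :: letters t)
    (2 * C + (16 * C + 13)) (by omega)
  obtain ⟨L, hL, hR⟩ := exists_bound R hK2
  obtain ⟨N, hN⟩ := Int.eq_ofNat_of_zero_le
    (show 0 ≤ 40 * C + 16 * L + 16 * (16 * C + 13) + 30 by omega)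
  obtain ⟨Q, hQ⟩ : ∃ Q, Q = t * u ^ N * R := ⟨_, rfl⟩
  obtain ⟨M, hM, hQM⟩ := exists_bound Q hK
  obtain ⟨N', hN'⟩ := Int.eq_ofNat_of_zero_le (show 0 ≤ 30 * (51 * M + 12) by omega)
  change _ = (N : ℤ) at hN
  change _ = (N' : ℤ) at hN'
  have hw : ∀ (S : Type) (A : Fin n → FreeGroup S),
      lift A (u ^ N' * Q) = lift A u ^ N' * lift A Q := by simp
  have hone : ∀ (S : Type) (A : Fin n → FreeGroup S), (∀ i j, Commute (A i) (A j)) →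
      lift A (u ^ N' * Q) = 1 := by
    intro S A hA
    obtain ⟨h1, h2⟩ := hcomm S A hA
    simp [hQ, h1, h2, hR1 S A h2, prod_letters h1]
  have haxis : ∀ (S : Type) (A : Fin n → FreeGroup S), lift A u ≠ 1 →
      ∃ p, D p (lift A u * p) = τ (lift A u) ∧ (∀ k, D p (A k * p) ≤ (K + 2) * τ (lift A u)) ∧
        D p (lift A Q * p) ≤ M * τ (lift A u) := by
    intro S A h
    obtain ⟨p, p1, p2⟩ := hu S A h
    have hl := τ_nonneg (lift A u)
    refine ⟨p, p1, fun k => (p2 k).trans ?_, hQM S A p _ hl p2⟩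
    gcongr
    omega
  have key : ∀ (S : Type) (A B : Fin n → FreeGroup S), ¬ (∀ i j, Commute (A i) (A j)) →
      ¬ (∀ i j, Commute (B i) (B j)) → lift A (u ^ N' * Q) = lift B (u ^ N' * Q) →
      Commute (lift A u) (lift B u) → A = B := by
    intro S A B hA hB hAB hc
    obtain ⟨a1, a2, a3⟩ := hncomm S A hA
    obtain ⟨b1, b2, b3⟩ := hncomm S B hB
    have hBu : lift B u = lift A u := by
      refine (eq_or_eq_inv_of_commute a1 a2 b2 b1 hc).resolve_right fun hinv => ?_
      obtain ⟨p, p1, p2, p3⟩ := haxis S A a1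
      obtain ⟨p', p1', p2', p3'⟩ := haxis S B b1
      rw [hw, hw, hinv, inv_pow, eq_inv_mul_iff_mul_eq, ← mul_assoc, ← pow_add] at hAB
      have h1 := τ_pow_mul_ge a1 p1 hM p3 (N' + N')
      rw [hAB] at h1
      rw [hinv, τ_inv] at p3'
      have h2 := τ_le p' (lift B Q)
      have hl := τ_pos a1
      have h3 : (M + 1) * τ (lift A u) ≤ ((N' + N' : ℕ) - (53 * M + 12)) * τ (lift A u) := by
        gcongr
        push_cast
        omega
      have h4 : (M + 1) * τ (lift A u) = M * τ (lift A u) + τ (lift A u) := by ring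
      omega
    rw [hw, hw, hBu] at hAB
    exact eq_of_lift_eq (N := N) hu hC hL rfl ht hR hShift hN.le rfl hBu a1 a2 a3
      (by rwa [← hBu]) (by rw [← hQ]; exact mul_left_cancel hAB)
  refine ⟨u ^ N' * Q, hone, fun S A hA => ?_, fun S A B hAB hA1 => ?_⟩
  · obtain ⟨h1, -, h3⟩ := hncomm S A hA
    obtain ⟨p, p1, p2, p3⟩ := haxis S A h1
    have hl := τ_pos h1
    refine ⟨fun h4 => ?_, ?_⟩
    · have h5 := τ_pow_mul_ge h1 p1 hM p3 N'
      rw [← hw, h4, τ_one] at h5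
      have h6 : 1 * τ (lift A u) ≤ (N' - (53 * M + 12)) * τ (lift A u) := by
        gcongr
        omega
      omega
    · rintro ⟨v, k, hk, hv⟩
      rw [hw] at hv
      have h5 := commute_of_pow_eq h1 p1 hM p3 hN'.le hk hv
      have q1 := ht S A p (τ (lift A u)) (by omega) p2
      have q2 := hR S A p (τ (lift A u)) (by omega) p2
      have q3 : (C + L) * τ (lift A u) = C * τ (lift A u) + L * τ (lift A u) := by ring
      have q4 : 0 ≤ C * τ (lift A u) := by positivity
      have q5 : 0 ≤ L * τ (lift A u) := by positivity
      exact (hncomm S A hA).2.2 (commute_left_of_commute (N := N) (R' := lift A R) h1 p1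
        (K := C + L) (by omega) (by omega) (by omega) (by omega) (by simp [hQ]) h5)
  · have hA : ¬ ∀ i j, Commute (A i) (A j) := fun h => hA1 (hone S A h)
    have hB : ¬ ∀ i j, Commute (B i) (B j) := fun h => hA1 (hAB.trans (hone S B h))
    obtain ⟨b1, b2, b3⟩ := hncomm S B hB
    obtain ⟨p', p1', p2', p3'⟩ := haxis S B b1
    obtain ⟨a1, a2, a3⟩ := hncomm S A hA
    obtain ⟨p, p1, p2, p3⟩ := haxis S A a1
    obtain ⟨i, hi⟩ := exists_commute_conj a1 b1 p1 p1' hM p3 p3' hN'.le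
      (by rw [← hw, ← hw, hAB])
    rw [← hw] at hi
    set s := lift A (u ^ N' * Q) ^ i with hs
    refine ⟨s, fun k => ?_⟩
    have hconj : ∀ w, lift (fun k => s * A k * s⁻¹) w = s * lift A w * s⁻¹ := lift_conj A s
    have hAB' : lift (fun k => s * A k * s⁻¹) (u ^ N' * Q) = lift B (u ^ N' * Q) := by
      rw [hconj, ← hAB, hs, (((Commute.refl _).zpow_left i)).eq, mul_inv_cancel_right]
    have c1 : lift (fun k => s * A k * s⁻¹) u ≠ 1 := by rw [hconj]; simpa using a1
    rw [← hconj] at hi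
    exact congrFun (key S _ B (fun h => c1 (hcomm S _ h).2) hB hAB' hi) k

end LeeWord

/-- (Lee) For every `n ≥ 2` there is a C-test word in `n` letters which is not a proper power
and which vanishes on a tuple exactly when the tuple generates a cyclic subgroup. -/
theorem exists_leeWord (n : ℕ) (hn : 2 ≤ n) :
    ∃ w : FreeGroup (Fin n),
      (∀ S : Type, Nontrivial S → IsCTestWord n w S) ∧
      ¬ IsProperPower w ∧
      (∀ (S : Type) (A : Fin n → FreeGroup S),
        FreeGroup.lift A w = 1 ↔
          ∃ g : FreeGroup S, Subgroup.closure (Set.range A) = Subgroup.zpowers g) := by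
  obtain ⟨w, h1, h2, h3⟩ := LeeWord.exists_word n
  have hof : ¬ ∀ i j : Fin n, Commute (FreeGroup.of i) (FreeGroup.of j) := by
    intro h
    have h01 := (h ⟨0, by omega⟩ ⟨1, by omega⟩).eq
    have := congrArg FreeGroup.toWord h01
    simp [FreeGroup.toWord_mul, FreeGroup.toWord_of, FreeGroup.reduce] at this
  obtain ⟨hw1, hw2⟩ := h2 (Fin n) FreeGroup.of hof
  rw [FreeGroup.lift_of_eq_id] at hw1 hw2
  refine ⟨w, fun S _ => ⟨hw1, fun A B => h3 S A B⟩, hw2, fun S A => ⟨fun h => ?_, ?_⟩⟩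
  · refine LeeWord.exists_zpowers_closure A ?_
    by_contra hA
    exact (h2 S A hA).1 h
  · rintro ⟨g, hg⟩
    refine h1 S A fun i j => ?_
    have hmem : ∀ k, ∃ m : ℤ, g ^ m = A k := fun k => by
      have : A k ∈ Subgroup.zpowers g := hg ▸ Subgroup.subset_closure ⟨k, rfl⟩
      exact this
    obtain ⟨a, ha⟩ := hmem i
    obtain ⟨b, hb⟩ := hmem j
    rw [← ha, ← hb]
    exact ((Commute.refl g).zpow_left a).zpow_right b
end

section
/- Let w ∈ F₂ be non-trivial and assume that w does not lie in the subgroup ⟨x y x⁻¹, y⟩ for any basis (x, y) of F₂. Then F₂ admits no cyclic splitting as an HNN extension relative to w: there is no splitting of F₂ as an HNN extension with base group H ≤ F₂, infinite cyclic associated subgroups A, B ≤ H, and stable letter t ∈ F₂, such that some conjugate of w lies in H. -/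
/-- `G` splits as an HNN extension with base the subgroup `H`, associated subgroups
`A, B ≤ H` identified by `ψ`, and stable letter `t`: the relation `t a t⁻¹ = ψ(a)` holds
in `G`, and the canonical homomorphism from `HNNExtension ↥H A B ψ` to `G` which restricts
to the inclusion on `H` and sends the stable letter to `t` is an isomorphism. -/
def SplitsAsHNN {G : Type*} [Group G] (H : Subgroup G) (A B : Subgroup ↥H)
    (ψ : A ≃* B) (t : G) : Prop :=
  ∃ hcomp : ∀ a : A, t * H.subtype a = H.subtype (ψ a) * t,
    Function.Bijective (HNNExtension.lift H.subtype t hcomp)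

namespace FreeGroup

section Crossings

variable {α V : Type*} [MulAction (FreeGroup α) V]

/-- The edge of the Schreier graph of an action of a free group, given by its label and its
initial vertex, along which the letter `p` moves the vertex `v`. -/
def crossing (p : α × Bool) (v : V) : α × V :=
  (p.1, if p.2 then v else (of p.1)⁻¹ • v)

/-- The edges of the Schreier graph crossed by the path which starts at a given vertex and reads
a given word from right to left. -/
def crossings : List (α × Bool) → V → List (α × V)
  | [], _ => []
  | p :: L, v => crossing p (mk L • v) :: crossings L v

theorem mk_cons_smul (p : α × Bool) (L : List (α × Bool)) (v : V) :
    mk (p :: L) • v = mk [p] • mk L • v := by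
  rw [smul_smul, mul_mk]; rfl

theorem mk_append_smul (L₁ L₂ : List (α × Bool)) (v : V) :
    mk (L₁ ++ L₂) • v = mk L₁ • mk L₂ • v := by
  rw [smul_smul, mul_mk]

theorem mk_singleton_false (i : α) : mk [(i, false)] = (of i)⁻¹ := rfl

theorem mk_singleton_true (i : α) : mk [(i, true)] = of i := rfl

theorem crossing_not (p : α × Bool) (v : V) :
    crossing (p.1, !p.2) (mk [p] • v) = crossing p v := by
  obtain ⟨i, _ | _⟩ := p <;> simp [crossing, mk_singleton_false, mk_singleton_true]

theorem crossing_eq_crossing_iff {p q : α × Bool} {v w : V} :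
    crossing p v = crossing q w ↔
      (p = q ∧ v = w) ∨ (p = (q.1, !q.2) ∧ v = mk [q] • w) := by
  obtain ⟨i, _ | _⟩ := p <;> obtain ⟨j, _ | _⟩ := q <;>
    simp only [crossing, mk_singleton_false, mk_singleton_true, Prod.mk.injEq] <;>
    by_cases h : i = j <;> simp [h, inv_smul_eq_iff, eq_inv_smul_iff]

theorem crossings_append (L₁ L₂ : List (α × Bool)) (v : V) :
    crossings (L₁ ++ L₂) v = crossings L₁ (mk L₂ • v) ++ crossings L₂ v := by
  induction L₁ with
  | nil => rfl
  | cons p L ih => simp [crossings, ih, mk_append_smul]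

theorem mem_crossings_invRev {ε : α × V} (L : List (α × Bool)) (v : V) :
    ε ∈ crossings (invRev L) (mk L • v) ↔ ε ∈ crossings L v := by
  induction L with
  | nil => simp [crossings, invRev]
  | cons p L ih =>
    have h : mk (invRev [p]) • mk [p] • mk L • v = mk L • v := by
      rw [← inv_mk, inv_smul_smul]
    rw [invRev_cons, crossings_append, mk_cons_smul, h, List.mem_append, ih, crossings,
      List.mem_cons, or_comm]
    simp [crossings, invRev, crossing_not, ← one_eq_mk]

theorem map_crossings {W : Type*} [MulAction (FreeGroup α) W] (f : V → W)
    (hf : ∀ (g : FreeGroup α) v, f (g • v) = g • f v) (L : List (α × Bool)) (v : V) :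
    (crossings L v).map (Prod.map id f) = crossings L (f v) := by
  induction L with
  | nil => rfl
  | cons p L ih =>
    obtain ⟨i, _ | _⟩ := p <;> simp [crossings, crossing, ih, hf]

theorem exists_append_of_mem_crossings {ε : α × V} {L : List (α × Bool)} {v : V}
    (h : ε ∈ crossings L v) :
    ∃ L₁ p L₂, L = L₁ ++ p :: L₂ ∧ crossing p (mk L₂ • v) = ε := by
  induction L with
  | nil => simp [crossings] at h
  | cons p L ih =>
    rcases List.mem_cons.1 h with h | h
    · exact ⟨[], p, L, rfl, h.symm⟩
    · obtain ⟨L₁, q, L₂, rfl, hq⟩ := ih h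
      exact ⟨p :: L₁, q, L₂, rfl, hq⟩

/-- The element `g` is represented by a word whose path from `v` in the Schreier graph does not
cross the edge `ε`. -/
def Avoids (ε : α × V) (v : V) (g : FreeGroup α) : Prop :=
  ∃ L, mk L = g ∧ ε ∉ crossings L v

namespace Avoids

variable {ε : α × V} {v : V} {g h : FreeGroup α}

theorem one : Avoids ε v 1 := ⟨[], rfl, by simp [crossings]⟩

theorem mul (hg : Avoids ε (h • v) g) (hh : Avoids ε v h) : Avoids ε v (g * h) := by
  obtain ⟨L, rfl, hL⟩ := hg
  obtain ⟨L', rfl, hL'⟩ := hh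
  exact ⟨L ++ L', mul_mk.symm, by simp [crossings_append, hL, hL']⟩

theorem inv (hg : Avoids ε v g) : Avoids ε (g • v) g⁻¹ := by
  obtain ⟨L, rfl, hL⟩ := hg
  exact ⟨invRev L, inv_mk.symm, by rwa [mem_crossings_invRev]⟩

theorem singleton {p : α × Bool} (hp : crossing p v ≠ ε) : Avoids ε v (mk [p]) :=
  ⟨[p], rfl, by simpa [crossings, one_smul, ← one_eq_mk] using hp.symm⟩

theorem inv_mul (hg : Avoids ε v g) (hh : Avoids ε v h) (hgh : g • v = h • v) :
    Avoids ε v (g⁻¹ * h) :=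
  mul (hgh ▸ hg.inv) hh

end Avoids

/-- The loops at `v` in the Schreier graph which do not cross the edge `ε`. -/
def loopsAvoiding (ε : α × V) (v : V) : Subgroup (FreeGroup α) where
  carrier := {g | g • v = v ∧ Avoids ε v g}
  one_mem' := ⟨one_smul _ _, .one⟩
  mul_mem' := fun {g h} hg hh =>
    ⟨by rw [mul_smul, hh.1, hg.1], .mul (by rw [hh.1]; exact hg.2) hh.2⟩
  inv_mem' := fun {g} hg => ⟨inv_smul_eq_iff.2 hg.1.symm, by simpa only [hg.1] using hg.2.inv⟩

/-- If a loop `a` at `u` crosses the edge `ε` exactly once, then every element is the product of an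
element whose path avoids `ε` and an element generated by `a` and the loops avoiding `ε`. -/
theorem exists_avoids_mul_mem_closure {ε : α × V} {u : V} {x y : FreeGroup α} {p : α × Bool}
    (ha : (x * mk [p] * y) • u = u) (hp : crossing p (y • u) = ε) (hy : Avoids ε u y)
    (hx : Avoids ε u x⁻¹) (g : FreeGroup α) :
    ∃ z k, g = z * k ∧ Avoids ε u z ∧
      k ∈ Subgroup.closure (loopsAvoiding ε u ∪ {x * mk [p] * y}) := by
  set K := Subgroup.closure (loopsAvoiding ε u ∪ {x * mk [p] * y}) with hK
  have haK : x * mk [p] * y ∈ K := Subgroup.subset_closure (by simp)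
  have hLK : loopsAvoiding ε u ≤ K := fun g hg => Subgroup.subset_closure (by simp [hg])
  have hKu : ∀ k ∈ K, k • u = u := by
    suffices K ≤ MulAction.stabilizer (FreeGroup α) u from fun k hk => this hk
    rw [hK, Subgroup.closure_le]
    rintro g (hg | rfl)
    exacts [hg.1, ha]
  have hxu : x⁻¹ • u = mk [p] • y • u := by
    rw [inv_smul_eq_iff, smul_smul, smul_smul]; simpa [mul_assoc] using ha.symm
  obtain ⟨L, rfl⟩ := Quot.exists_rep g
  change ∃ z k, mk L = z * k ∧ _
  induction L with
  | nil => exact ⟨1, 1, by simp [← one_eq_mk], .one, one_mem _⟩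
  | cons q L ih =>
    obtain ⟨z, k, hL, hz, hk⟩ := ih
    have hq : mk (q :: L) = mk [q] * z * k := by
      rw [mul_assoc, ← hL, mul_mk]; rfl
    by_cases h : crossing q (z • u) = ε
    · rw [← hp, crossing_eq_crossing_iff] at h
      rcases h with ⟨rfl, h⟩ | ⟨rfl, h⟩
      · refine ⟨x⁻¹, (x * mk [q] * y) * (y⁻¹ * z) * k, by rw [hq]; group, hx, ?_⟩
        refine mul_mem (mul_mem haK (hLK ⟨?_, hy.inv_mul hz h.symm⟩)) hk
        rw [mul_smul, h, inv_smul_smul]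
      · refine ⟨y, (x * mk [p] * y)⁻¹ * (x * z) * k, ?_, hy, ?_⟩
        · have : mk [(p.1, !p.2)] = (mk [p])⁻¹ := by simp [invRev]
          rw [hq, this]; group
        · rw [← hxu] at h
          refine mul_mem (mul_mem (inv_mem haK) (hLK ⟨?_, ?_⟩)) hk
          · rw [mul_smul, h, smul_inv_smul]
          · simpa using hx.inv_mul hz h.symm
    · exact ⟨mk [q] * z, k, hq, (Avoids.singleton h).mul hz, hk⟩

/-- Labels on the edges of the Schreier graph extend to a cocycle. -/
theorem exists_cocycle {M : Type*} [Group M] (c : α → V → M) :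
    ∃ σ : FreeGroup α → V → M, (∀ g h v, σ (g * h) v = σ g (h • v) * σ h v) ∧
      ∀ i v, σ (of i) v = c i v := by
  let P : α → Equiv.Perm (V × M) := fun i =>
    { toFun := fun x => (of i • x.1, c i x.1 * x.2)
      invFun := fun x => ((of i)⁻¹ • x.1, (c i ((of i)⁻¹ • x.1))⁻¹ * x.2)
      left_inv := fun x => by simp
      right_inv := fun x => by simp }
  have key : ∀ g v m, lift P g (v, m) = (g • v, (lift P g (v, 1)).2 * m) := by
    intro g
    induction g using FreeGroup.induction_on with
    | C1 => simp
    | of i => intro v m; simp [P]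
    | inv_of i _ =>
      intro v m
      simp only [_root_.map_inv, lift_apply_of]
      rw [Equiv.Perm.inv_def]
      simp [P]
    | mul g h hg hh =>
      intro v m
      rw [_root_.map_mul, Equiv.Perm.mul_apply, Equiv.Perm.mul_apply, hh v m, hg, hh v 1,
        hg (h • v)]
      simp [mul_smul, mul_assoc, hg (h • v) (lift P h (v, 1)).2]
  refine ⟨fun g v => (lift P g (v, 1)).2, fun g h v => ?_, fun i v => by simp [P]⟩
  dsimp only
  rw [_root_.map_mul, Equiv.Perm.mul_apply, key h v 1, key g]

theorem Avoids.cocycle_eq {σ : FreeGroup α → V → FreeGroup α}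
    (hσ : ∀ g h v, σ (g * h) v = σ g (h • v) * σ h v) {ε : α × V}
    (hσε : ∀ i v, (i, v) ≠ ε → σ (of i) v = of i) {v : V} {g : FreeGroup α}
    (hg : Avoids ε v g) : σ g v = g := by
  have h1 : ∀ v, σ 1 v = 1 := fun v => by simpa using hσ 1 1 v
  obtain ⟨L, rfl, hL⟩ := hg
  induction L with
  | nil => exact h1 v
  | cons p L ih =>
    simp only [crossings, List.mem_cons, not_or] at hL
    have hp : mk (p :: L) = mk [p] * mk L := by rw [mul_mk]; rfl
    rw [hp, hσ, ih hL.2]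
    congr 1
    obtain ⟨i, _ | _⟩ := p
    · have := hσ (of i) (of i)⁻¹ (mk L • v)
      rw [mul_inv_cancel, h1, hσε i ((of i)⁻¹ • mk L • v) (fun h => hL.1 h.symm)] at this
      exact (inv_eq_of_mul_eq_one_right this.symm).symm
    · exact hσε _ _ (Ne.symm hL.1)

end Crossings

end FreeGroup

namespace FreeGroup

/-- A subgroup of the free group of rank two which is a retract with a complementary
homomorphism to `ℤ` is cyclic. -/
theorem exists_eq_zpowers_of_retract {K : Subgroup (FreeGroup (Fin 2))}
    (F : FreeGroup (Fin 2) →* FreeGroup (Fin 2)) (hF : ∀ g, F g ∈ K) (hFK : ∀ k ∈ K, F k = k)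
    (π : FreeGroup (Fin 2) →* Multiplicative ℤ) (hπ : ∀ k ∈ K, π k = 1) {τ : FreeGroup (Fin 2)}
    (hFτ : F τ = 1) (hπτ : π τ = Multiplicative.ofAdd 1) :
    ∃ y, K = Subgroup.zpowers y := by
  have hsub : Subsingleton (IsFreeGroup.Generators K) := by
    by_contra hns
    obtain ⟨i, j, hij⟩ := (not_subsingleton_iff_nontrivial.1 hns).exists_pair_ne
    classical
    let χ (i : IsFreeGroup.Generators K) : FreeGroup (Fin 2) →* Multiplicative (ZMod 2) :=
      (IsFreeGroup.lift fun j => Multiplicative.ofAdd (if j = i then 1 else 0)).comp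
        (F.codRestrict K hF)
    let ϖ : FreeGroup (Fin 2) →* Multiplicative (ZMod 2) :=
      (AddMonoidHom.toMultiplicative (Int.castAddHom (ZMod 2))).comp π
    have hχ (k l) : χ k ((IsFreeGroup.of l : K) : FreeGroup (Fin 2)) =
        Multiplicative.ofAdd (if l = k then 1 else 0) := by
      have : F.codRestrict K hF ((IsFreeGroup.of l : K) : FreeGroup (Fin 2)) = IsFreeGroup.of l :=
        Subtype.ext (hFK _ (IsFreeGroup.of l : K).2)
      simp only [χ, MonoidHom.comp_apply, this, IsFreeGroup.lift_of]
    have hχτ (k) : χ k τ = 1 := by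
      have : F.codRestrict K hF τ = 1 := Subtype.ext hFτ
      simp only [χ, MonoidHom.comp_apply, this, _root_.map_one]
    have hϖ (l) : ϖ ((IsFreeGroup.of l : K) : FreeGroup (Fin 2)) = 1 := by
      simp only [ϖ, MonoidHom.comp_apply, hπ _ (IsFreeGroup.of l : K).2, _root_.map_one]
    have hϖτ : ϖ τ = Multiplicative.ofAdd 1 := by
      simp [ϖ, hπτ]
    let Ψ (c : ZMod 2 × ZMod 2 × ZMod 2) : FreeGroup (Fin 2) →* Multiplicative (ZMod 2) :=
      χ i ^ c.1.val * χ j ^ c.2.1.val * ϖ ^ c.2.2.val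
    have hinj : Function.Injective fun c : ZMod 2 × ZMod 2 × ZMod 2 =>
        fun l : Fin 2 => Ψ c (of l) := by
      intro c d hcd
      have hΨ : Ψ c = Ψ d := FreeGroup.ext_hom _ _ fun l => congrFun hcd l
      have h1 := DFunLike.congr_fun hΨ ((IsFreeGroup.of i : K) : FreeGroup (Fin 2))
      have h2 := DFunLike.congr_fun hΨ ((IsFreeGroup.of j : K) : FreeGroup (Fin 2))
      have h3 := DFunLike.congr_fun hΨ τ
      simp only [Ψ, MonoidHom.mul_apply, MonoidHom.pow_apply, hχ, hϖ, hχτ, hϖτ, hij, hij.symm,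
        if_true, if_false, ofAdd_zero, one_pow, one_mul, mul_one, ← ofAdd_nsmul,
        EmbeddingLike.apply_eq_iff_eq, nsmul_eq_mul, ZMod.natCast_val, ZMod.cast_id] at h1 h2 h3
      exact Prod.ext h1 (Prod.ext h2 h3)
    have hcard := Fintype.card_le_of_injective _ hinj
    simp [ZMod.card] at hcard
  obtain ⟨y, hy⟩ : ∃ y : K, ∀ k, k ∈ Subgroup.zpowers y := by
    have hcl : Subgroup.closure
        (Set.range (IsFreeGroup.of : IsFreeGroup.Generators K → K)) = ⊤ := by
      have := FreeGroup.closure_range_of (IsFreeGroup.Generators K)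
      have h2 := congrArg (Subgroup.map (IsFreeGroup.toFreeGroup K).symm.toMonoidHom) this
      rw [MonoidHom.map_closure, ← Set.range_comp, Subgroup.map_top_of_surjective _
        (IsFreeGroup.toFreeGroup K).symm.surjective] at h2
      exact h2
    rcases isEmpty_or_nonempty (IsFreeGroup.Generators K) with hE | ⟨⟨i⟩⟩
    · refine ⟨1, fun k => ?_⟩
      have : k ∈ (⊤ : Subgroup K) := trivial
      rw [← hcl, Set.range_eq_empty, Subgroup.closure_empty, Subgroup.mem_bot] at this
      simp [this]
    · refine ⟨IsFreeGroup.of i, fun k => ?_⟩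
      have : k ∈ (⊤ : Subgroup K) := trivial
      have hr : Set.range (IsFreeGroup.of : IsFreeGroup.Generators K → K) = {IsFreeGroup.of i} := by
        ext z
        simp only [Set.mem_range, Set.mem_singleton_iff]
        exact ⟨fun ⟨l, hl⟩ => by rw [← hl, Subsingleton.elim l i], fun h => ⟨i, h.symm⟩⟩
      rwa [← hcl, hr, ← Subgroup.zpowers_eq_closure] at this
  refine ⟨y, le_antisymm (fun k hk => ?_) (by simp)⟩
  obtain ⟨n, hn⟩ := hy ⟨k, hk⟩
  exact ⟨n, by simpa using congrArg Subtype.val hn⟩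

end FreeGroup

/-- An action of `G` together with a vertex `u` whose stabilizer is the base of a splitting of `G`
as an HNN extension with stable letter `t` in which the associated subgroups are generated
by `a` and `t * a * t⁻¹`, expressed by means of the universal property. -/
structure IsCyclicHNNAt {G V : Type} [Group G] [MulAction G V] (u : V) (t a : G) : Prop where
  smul_eq : a • u = u
  conj_smul_eq : (t * a * t⁻¹) • u = u
  closure_eq_top : Subgroup.closure (MulAction.stabilizer G u ∪ {t}) = ⊤
  exists_lift : ∀ (M : Type) [Group M] (f : G → M) (s : M),
    (∀ g h, g • u = u → h • u = u → f (g * h) = f g * f h) →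
    s * f a = f (t * a * t⁻¹) * s →
    ∃ F : G →* M, (∀ g, g • u = u → F g = f g) ∧ F t = s

namespace IsCyclicHNNAt

variable {G V : Type} [Group G] [MulAction G V] {u : V} {t a : G}

theorem smul_inv_smul_eq (h : IsCyclicHNNAt u t a) : a • t⁻¹ • u = t⁻¹ • u := by
  have := h.conj_smul_eq
  rwa [mul_smul, mul_smul, ← eq_inv_smul_iff] at this

theorem conj (h : IsCyclicHNNAt u t a) (c : G) :
    IsCyclicHNNAt (c • u) (c * t * c⁻¹) (c * a * c⁻¹) where
  smul_eq := by simp [mul_smul, h.smul_eq]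
  conj_smul_eq := by
    have := h.conj_smul_eq
    simp only [mul_smul] at this
    simp [mul_smul, this]
  closure_eq_top := by
    have := congrArg (Subgroup.map (MulAut.conj c).toMonoidHom) h.closure_eq_top
    rw [MonoidHom.map_closure, Subgroup.map_top_of_surjective _ (MulAut.conj c).surjective] at this
    rw [← this, Set.image_union, Set.image_singleton,
      MulAction.stabilizer_smul_eq_stabilizer_map_conj]
    simp
  exists_lift := fun M _ f s hf hs => by
    obtain ⟨F, hF, hFt⟩ := h.exists_lift M (fun g => f (c * g * c⁻¹)) s
      (fun g k hg hk => by
        rw [← hf _ _ (by simp [mul_smul, hg]) (by simp [mul_smul, hk])]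
        congr 1; group)
      (by rw [hs]; congr 2; group)
    refine ⟨F.comp (MulAut.conj c⁻¹).toMonoidHom, fun g hg => ?_, ?_⟩
    · have := hF (c⁻¹ * g * c) (by rw [mul_smul, mul_smul, hg, inv_smul_smul])
      simp only [MonoidHom.comp_apply, MulEquiv.coe_toMonoidHom, MulAut.conj_apply, inv_inv]
      rw [this]; congr 1; group
    · simp only [MonoidHom.comp_apply, MulEquiv.coe_toMonoidHom, MulAut.conj_apply, inv_inv]
      rw [← hFt]; congr 1; group

theorem symm (h : IsCyclicHNNAt u t a) : IsCyclicHNNAt u t⁻¹ (t * a * t⁻¹) where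
  smul_eq := h.conj_smul_eq
  conj_smul_eq := by simpa [mul_assoc] using h.smul_eq
  closure_eq_top := by
    rw [← h.closure_eq_top]
    apply le_antisymm <;> rw [Subgroup.closure_le] <;> rintro g (hg | rfl)
    · exact Subgroup.subset_closure (.inl hg)
    · exact inv_mem (Subgroup.subset_closure (by simp))
    · exact Subgroup.subset_closure (.inl hg)
    · exact inv_mem_iff.1 (Subgroup.subset_closure (by simp))
  exists_lift := fun M _ f s hf hs => by
    have e : t⁻¹ * (t * a * t⁻¹) * t⁻¹⁻¹ = a := by group
    rw [e] at hs
    obtain ⟨F, hF, hFt⟩ := h.exists_lift M f s⁻¹ hf (by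
      rw [inv_mul_eq_iff_eq_mul, ← mul_assoc, hs, mul_inv_cancel_right])
    exact ⟨F, hF, by rw [map_inv, hFt, inv_inv]⟩

end IsCyclicHNNAt

namespace FreeGroup

/-- If the word `L` representing the edge generator `a` reads a loop at `u` which crosses the
edge `ε` of the Schreier graph exactly once, and a loop at `t⁻¹ • u` which avoids it, then the base
of the HNN extension is contained in `⟨x y x⁻¹, y⟩` for a basis `(x, y)`. -/
theorem exists_basis_of_crosses_once {V : Type} [MulAction (FreeGroup (Fin 2)) V] {u : V}
    {t x₀ y₀ : FreeGroup (Fin 2)} {p : Fin 2 × Bool} {ε : Fin 2 × V}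
    (h : IsCyclicHNNAt u t (x₀ * mk [p] * y₀))
    (hp : crossing p (y₀ • u) = ε) (hy : Avoids ε u y₀) (hx : Avoids ε u x₀⁻¹)
    (hw : Avoids ε (t⁻¹ • u) (x₀ * mk [p] * y₀)) :
    ∃ x y : FreeGroup (Fin 2), Subgroup.closure {x, y} = ⊤ ∧
      MulAction.stabilizer (FreeGroup (Fin 2)) u ≤ Subgroup.closure {x * y * x⁻¹, y} := by
  classical
  set a := x₀ * mk [p] * y₀ with ha
  have hau := h.smul_eq
  have hmem := exists_avoids_mul_mem_closure hau hp hy hx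
  rw [← ha] at hmem
  set N := loopsAvoiding ε u with hN
  have hK : Subgroup.closure (N ∪ {a}) ≤ MulAction.stabilizer (FreeGroup (Fin 2)) u := by
    rw [Subgroup.closure_le]
    rintro g (hg | rfl)
    exacts [hg.1, hau]
  have hstab : MulAction.stabilizer (FreeGroup (Fin 2)) u ≤ Subgroup.closure (N ∪ {a}) := by
    intro g hg
    obtain ⟨z, k, rfl, hz, hk⟩ := hmem g
    refine mul_mem (Subgroup.subset_closure (.inl ⟨?_, hz⟩)) hk
    have hku : k • u = u := hK hk
    simpa [mul_smul, hku] using hg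
  obtain ⟨τ, k, ht, hτ, hk⟩ := hmem t⁻¹
  have hku : k • u = u := hK hk
  have hτu : t⁻¹ • u = τ • u := by rw [ht, mul_smul, hku]
  have htτ : t = k⁻¹ * τ⁻¹ := by rw [← inv_inv t, ht, mul_inv_rev]
  set b := τ⁻¹ * a * τ with hb
  have hbN : b ∈ N := by
    have haτ : a • τ • u = τ • u := by rw [← hτu, h.smul_inv_smul_eq]
    rw [hb, mul_assoc]
    refine ⟨by rw [mul_smul, mul_smul, haτ, inv_smul_smul], hτ.inv_mul (.mul ?_ hτ) ?_⟩
    · rwa [← hτu]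
    · rw [mul_smul, haτ]
  have hab : a = τ * b * τ⁻¹ := by rw [hb]; group
  have hgen : Subgroup.closure (N ∪ {τ}) = ⊤ := by
    set Q := Subgroup.closure (N ∪ {τ} : Set (FreeGroup (Fin 2))) with hQ
    have hτQ : τ ∈ Q := Subgroup.subset_closure (by simp)
    have hNQ : N ≤ Q := fun g hg => Subgroup.subset_closure (.inl hg)
    have hKQ : Subgroup.closure (N ∪ {a}) ≤ Q := by
      rw [Subgroup.closure_le]
      rintro g (hg | rfl)
      · exact hNQ hg
      · rw [hab]; exact mul_mem (mul_mem hτQ (hNQ hbN)) (inv_mem hτQ)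
    rw [eq_top_iff, ← h.closure_eq_top, Subgroup.closure_le]
    rintro g (hg | rfl)
    · exact hKQ (hstab hg)
    · rw [htτ]; exact mul_mem (inv_mem (hKQ hk)) (inv_mem hτQ)
  obtain ⟨F, hFN, hFτ⟩ : ∃ F : FreeGroup (Fin 2) →* FreeGroup (Fin 2),
      (∀ g ∈ N, F g = g) ∧ F τ = 1 := by
    set q := x₀⁻¹ * b * y₀⁻¹ with hq
    obtain ⟨σ, hσ, hσc⟩ := exists_cocycle (α := Fin 2) (V := V) (M := FreeGroup (Fin 2))
      fun i v => if (i, v) = ε then (if p.2 then q else q⁻¹) else of i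
    have hσε : ∀ i v, (i, v) ≠ ε → σ (of i) v = of i := fun i v hi => by rw [hσc, if_neg hi]
    have h1 : ∀ v, σ 1 v = 1 := fun v => by simpa using hσ 1 1 v
    have hσp : σ (mk [p]) (y₀ • u) = q := by
      obtain ⟨i, _ | _⟩ := p
      · have := hσ (of i) (of i)⁻¹ (y₀ • u)
        rw [mul_inv_cancel, h1, hσc, if_pos (by simpa [crossing] using hp)] at this
        rw [mk_singleton_false]
        exact (inv_mul_eq_one.1 (by simpa using this.symm)).symm
      · rw [mk_singleton_true, hσc, if_pos (by simpa [crossing] using hp)]; simp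
    have hσa : σ a u = b := by
      have hx' : Avoids ε (mk [p] • y₀ • u) x₀ := by
        have := hx.inv
        rwa [inv_inv, show x₀⁻¹ • u = mk [p] • y₀ • u by
          rw [inv_smul_eq_iff, smul_smul, smul_smul]; exact hau.symm] at this
      rw [ha, hσ, hσ, hσp, hy.cocycle_eq hσ hσε, hx'.cocycle_eq hσ hσε, hq]
      group
    have hσN : ∀ g ∈ N, σ g u = g := fun g hg => hg.2.cocycle_eq hσ hσε
    have hmul : ∀ g h, g • u = u → h • u = u → σ (g * h) u = σ g u * σ h u :=
      fun g h _ hh => by rw [hσ, hh]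
    have hkinv : σ k⁻¹ u = (σ k u)⁻¹ := by
      have := hmul k⁻¹ k (by rw [inv_smul_eq_iff, hku]) hku
      rw [inv_mul_cancel, h1] at this
      exact eq_inv_of_mul_eq_one_left this.symm
    have hbu : b • u = u := hbN.1
    have hkinvu : k⁻¹ • u = u := by rw [inv_smul_eq_iff, hku]
    obtain ⟨F, hF, hFt⟩ := h.exists_lift _ (fun g => σ g u) (σ k u)⁻¹ hmul (by
      have : t * a * t⁻¹ = k⁻¹ * (b * k) := by rw [htτ, hb]; group
      simp only [this]
      rw [hmul _ _ hkinvu (by rw [mul_smul, hku, hbu]), hmul _ _ hbu hku, hkinv, hσa,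
        hσN b hbN]
      group)
    refine ⟨F, fun g hg => by rw [hF g hg.1, hσN g hg], ?_⟩
    have : τ = t⁻¹ * k⁻¹ := by rw [ht]; group
    rw [this, _root_.map_mul, _root_.map_inv, hFt, hF _ hkinvu, hkinv]
    group
  obtain ⟨π, hπ, hπt⟩ := h.exists_lift (Multiplicative ℤ) (fun _ => 1)
    (Multiplicative.ofAdd (-1)) (by simp) (by simp)
  have hFrange : ∀ g, F g ∈ N := by
    intro g
    have hg : g ∈ Subgroup.closure (N ∪ {τ} : Set (FreeGroup (Fin 2))) := hgen ▸ trivial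
    suffices Subgroup.closure (N ∪ {τ} : Set (FreeGroup (Fin 2))) ≤ N.comap F from this hg
    rw [Subgroup.closure_le]
    rintro g (hg | rfl)
    · simpa [hFN g hg] using hg
    · simp [hFτ, one_mem]
  have hπτ : π τ = Multiplicative.ofAdd 1 := by
    have : τ = t⁻¹ * k⁻¹ := by rw [ht]; group
    rw [this, _root_.map_mul, _root_.map_inv, _root_.map_inv, hπt, hπ k hku]
    simp
  obtain ⟨y, hNy⟩ := exists_eq_zpowers_of_retract F hFrange hFN π (fun g hg => hπ g hg.1)
    hFτ hπτ
  rw [hNy] at hgen hstab hbN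
  refine ⟨τ, y, ?_, hstab.trans ?_⟩
  · rw [eq_top_iff, ← hgen, Subgroup.closure_le]
    rintro g (hg | rfl)
    · exact Subgroup.zpowers_le.2 (Subgroup.subset_closure (by simp)) hg
    · exact Subgroup.subset_closure (by simp)
  · rw [Subgroup.closure_le]
    rintro g (hg | rfl)
    · exact Subgroup.zpowers_le.2 (Subgroup.subset_closure (by simp)) hg
    · obtain ⟨n, hn⟩ := hbN
      simp only at hn
      rw [hab, ← hn, ← conj_zpow]
      exact zpow_mem (Subgroup.subset_closure (by simp)) n

end FreeGroup

namespace FreeGroup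

section CyclicallyReduced

variable {α : Type*}

theorem IsCyclicallyReduced.append_comm {A B : List (α × Bool)}
    (h : IsCyclicallyReduced (A ++ B)) : IsCyclicallyReduced (B ++ A) := by
  have h3 := (h.flatten_replicate 3).isReduced
  have : IsReduced ((B ++ A) ++ (B ++ A)) := h3.infix ⟨A, B, by simp [List.replicate]⟩
  obtain ⟨h1, -, h2⟩ := List.isChain_append.1 this
  exact ⟨h1, h2⟩

theorem IsCyclicallyReduced.length_le_norm_zpow [DecidableEq α] {L : List (α × Bool)}
    (h : IsCyclicallyReduced L) {n : ℤ} (hn : n ≠ 0) : L.length ≤ (mk L ^ n).norm := by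
  have key (m : ℕ) (hm : m ≠ 0) : L.length ≤ (mk L ^ m).norm := by
    rw [norm, toWord_pow, toWord_mk, h.isReduced.reduce_eq,
      (h.flatten_replicate m).isReduced.reduce_eq, List.length_flatten, List.map_replicate,
      List.sum_replicate, smul_eq_mul]
    exact Nat.le_mul_of_pos_left _ (Nat.pos_of_ne_zero hm)
  obtain ⟨m, rfl | rfl⟩ := n.eq_nat_or_neg
  · rw [zpow_natCast]
    exact key m (by simpa using hn)
  · rw [zpow_neg, zpow_natCast, norm_inv_eq]
    exact key m (by simpa using hn)

theorem not_smul_eq_of_isCyclicallyReduced {E : Type*} [MulAction (FreeGroup α) E] {e : E}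
    {A W B : List (α × Bool)} (h : IsCyclicallyReduced (A ++ W ++ B)) (hA : A ≠ []) (hW : W ≠ [])
    (he : ∀ g : FreeGroup α, g • e = e → g ∈ Subgroup.zpowers (mk (A ++ W ++ B))) :
    mk W • mk B • e ≠ mk B • e := by
  classical
  intro hWB
  obtain ⟨n, hn⟩ := he ((mk B)⁻¹ * mk W * mk B)
    (by rw [mul_smul, mul_smul, hWB, inv_smul_smul])
  have hR : mk W = mk (B ++ (A ++ W)) ^ n := by
    have : mk (B ++ (A ++ W)) = mk B * mk (A ++ W ++ B) * (mk B)⁻¹ := by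
      simp only [← mul_mk]; group
    dsimp only at hn
    rw [this, conj_zpow, hn]; group
  have hWr : reduce W = W := (h.isReduced.infix ⟨A, B, rfl⟩).reduce_eq
  have hn0 : n ≠ 0 := by
    rintro rfl
    rw [zpow_zero, ← toWord_eq_nil_iff, toWord_mk, hWr] at hR
    exact hW hR
  have hle := h.append_comm.length_le_norm_zpow hn0
  rw [← hR, norm, toWord_mk, hWr] at hle
  have := List.length_pos_of_ne_nil hA
  simp only [List.length_append] at hle
  omega

theorem nodup_crossings {E : Type*} [MulAction (FreeGroup α) E] {e : E}
    {L : List (α × Bool)} (h : IsCyclicallyReduced L)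
    (he : ∀ g : FreeGroup α, g • e = e → g ∈ Subgroup.zpowers (mk L)) :
    (crossings L e).Nodup := by
  suffices ∀ L' A, L = A ++ L' → (crossings L' e).Nodup from this L [] rfl
  intro L'
  induction L' with
  | nil => simp [crossings]
  | cons p L' ih =>
    intro A hA
    rw [crossings, List.nodup_cons]
    refine ⟨fun hmem => ?_, ih (A ++ [p]) (by simp [hA])⟩
    obtain ⟨L₁, q, L₂, rfl, hq⟩ := exists_append_of_mem_crossings hmem
    rw [crossing_eq_crossing_iff] at hq
    rcases hq with ⟨rfl, hq⟩ | ⟨hqp, hq⟩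
    · have hL : L = (A ++ [q]) ++ (L₁ ++ [q]) ++ L₂ := by simp [hA]
      refine not_smul_eq_of_isCyclicallyReduced (hL ▸ h) (by simp) (by simp) (hL ▸ he) ?_
      refine Eq.trans ?_ hq.symm
      rw [← mk_append_smul]; simp
    · have hL : L = (A ++ [p]) ++ L₁ ++ (q :: L₂) := by simp [hA]
      by_cases hL₁ : L₁ = []
      · subst hL₁
        have hr : IsReduced [p, q] := h.isReduced.infix ⟨A, L₂, by simp [hL]⟩
        have := List.isChain_pair.1 hr
        simp [hqp] at this
      · refine not_smul_eq_of_isCyclicallyReduced (hL ▸ h) (by simp) hL₁ (hL ▸ he) ?_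
        have hpq : mk [p] • mk [q] • mk L₂ • e = mk L₂ • e := by
          rw [hqp]
          obtain ⟨i, _ | _⟩ := p <;> simp [mk_singleton_false, mk_singleton_true]
        rw [mk_append_smul, mk_cons_smul q L₂ e] at hq
        rw [mk_cons_smul q L₂ e, ← smul_left_cancel_iff (mk [p]), hpq]
        exact hq.symm

end CyclicallyReduced

end FreeGroup

/-- A finite nonempty set of edges of a tree has a leaf. The tree structure enters through a
potential `D` on the vertices whose coboundary is the identity. -/
theorem exists_leaf {E V : Type*} [DecidableEq E] [DecidableEq V] (ι τ : E → V)
    (D : V → E → ℚ) (hD : ∀ e, D (τ e) - D (ι e) = Pi.single e 1) {S : Finset E}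
    (hS : S.Nonempty) :
    ∃ x, (S.filter fun e => ι e = x).card + (S.filter fun e => τ e = x).card = 1 := by
  by_contra! hne
  set X := S.image ι ∪ S.image τ with hX
  have hι : ∀ e ∈ S, ι e ∈ X := fun e he => Finset.mem_union_left _ (Finset.mem_image_of_mem _ he)
  have hτ : ∀ e ∈ S, τ e ∈ X := fun e he => Finset.mem_union_right _ (Finset.mem_image_of_mem _ he)
  have hdeg : ∀ x ∈ X, 2 ≤ (S.filter fun e => ι e = x).card + (S.filter fun e => τ e = x).card := by
    intro x hx
    have h0 : 0 < (S.filter fun e => ι e = x).card + (S.filter fun e => τ e = x).card := by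
      rcases Finset.mem_union.1 hx with hx | hx <;> obtain ⟨e, he, rfl⟩ := Finset.mem_image.1 hx
      · exact Nat.add_pos_left (Finset.card_pos.2 ⟨e, by simp [he]⟩) _
      · exact Nat.add_pos_right _ (Finset.card_pos.2 ⟨e, by simp [he]⟩)
    have := hne x
    omega
  have hcard : X.card ≤ S.card := by
    have h := Finset.sum_le_sum hdeg
    rw [Finset.sum_add_distrib, ← Finset.card_eq_sum_card_fiberwise hι,
      ← Finset.card_eq_sum_card_fiberwise hτ, Finset.sum_const, smul_eq_mul] at h
    omega
  obtain ⟨e₁, he₁⟩ := hS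
  set v₁ := ι e₁ with hv₁
  let R (v : V) : S → ℚ := fun e => D v e - D v₁ e
  have hR (e : S) : R (τ e) - R (ι e) = Pi.single e 1 := by
    funext e'
    have := congrFun (hD e) e'
    simp only [Pi.sub_apply, Pi.single_apply, Subtype.ext_iff, R] at this ⊢
    rw [← this]; ring
  have hmem (v : V) (hv : v ∈ X) : R v ∈
      Submodule.span ℚ (((X.erase v₁).image R : Finset _) : Set (S → ℚ)) := by
    by_cases h : v = v₁
    · have : R v = 0 := by funext e; simp [R, h]
      rw [this]; exact zero_mem _
    · exact Submodule.subset_span (Finset.mem_coe.2 (Finset.mem_image_of_mem _ (by simp [h, hv])))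
  have htop : Submodule.span ℚ (((X.erase v₁).image R : Finset _) : Set (S → ℚ)) = ⊤ := by
    rw [eq_top_iff, ← (Pi.basisFun ℚ S).span_eq, Submodule.span_le]
    rintro _ ⟨e, rfl⟩
    rw [Pi.basisFun_apply, ← hR]
    exact sub_mem (hmem _ (hτ _ e.2)) (hmem _ (hι _ e.2))
  have hfin := finrank_span_finset_le_card (R := ℚ) ((X.erase v₁).image R)
  rw [Set.finrank, htop, finrank_top, Module.finrank_fintype_fun_eq_card, Fintype.card_coe] at hfin
  have h2 := Finset.card_image_le (s := X.erase v₁) (f := R)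
  rw [Finset.card_erase_of_mem (hι _ he₁)] at h2
  have h3 : 0 < X.card := Finset.card_pos.2 ⟨_, hι _ he₁⟩
  omega

/-- The orbit map of a point fixed by `a`, defined on the cosets of the subgroup generated by `a`. -/
def orbitMap {G V : Type*} [Group G] [MulAction G V] (a : G) (v : V) (h : a • v = v) :
    G ⧸ Subgroup.zpowers a → V :=
  Quotient.lift (fun g : G => g • v) fun g k hgk => by
    replace hgk := QuotientGroup.leftRel_apply.1 hgk
    have : Subgroup.zpowers a ≤ MulAction.stabilizer G v := Subgroup.zpowers_le.2 h
    have h2 : (g⁻¹ * k) • v = v := this hgk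
    rw [mul_smul, inv_smul_eq_iff] at h2
    exact h2.symm

theorem orbitMap_mk {G V : Type*} [Group G] [MulAction G V] {a : G} {v : V} (h : a • v = v)
    (g : G) : orbitMap a v h (g : G ⧸ Subgroup.zpowers a) = g • v := rfl

theorem orbitMap_smul {G V : Type*} [Group G] [MulAction G V] {a : G} {v : V} (h : a • v = v)
    (g : G) (e : G ⧸ Subgroup.zpowers a) : orbitMap a v h (g • e) = g • orbitMap a v h e := by
  induction e using QuotientGroup.induction_on with
  | H k => exact mul_smul g k v

namespace IsCyclicHNNAt

variable {G V : Type} [Group G] [MulAction G V] {u : V} {t a : G}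

/-- The Bass–Serre graph of a cyclic HNN extension is a tree. -/
theorem exists_potential [DecidableEq (G ⧸ Subgroup.zpowers a)] (h : IsCyclicHNNAt u t a) :
    ∃ D : V → G ⧸ Subgroup.zpowers a → ℚ, ∀ e,
      D (orbitMap a (t⁻¹ • u) h.smul_inv_smul_eq e) - D (orbitMap a u h.smul_eq e) =
        Pi.single e 1 := by
  classical
  let E := G ⧸ Subgroup.zpowers a
  let ρ (g : G) : Equiv.Perm (E → ℚ) := Equiv.arrowCongr (MulAction.toPerm g) (Equiv.refl ℚ)
  have hρ (g : G) (m : E → ℚ) (e : E) : ρ g m e = m (g⁻¹ • e) := rfl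
  have hρsingle (g : G) (e : E) : ρ g (Pi.single e 1) = Pi.single (g • e) 1 := by
    funext e'
    simp only [hρ, Pi.single_apply, inv_smul_eq_iff]
  have hρsub (g : G) (m m' : E → ℚ) : ρ g (m - m') = ρ g m - ρ g m' := rfl
  have hρmul (g k : G) (m : E → ℚ) : ρ (g * k) m = ρ g (ρ k m) := by
    funext e; simp only [hρ, mul_inv_rev, mul_smul]
  have hsingle (g : G) : Pi.single (M := fun _ : E => ℚ) ((g : G) : E) 1 =
      Pi.single (g • ((1 : G) : E)) 1 := by
    congr 1
    change _ = ((g * 1 : G) : E)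
    rw [mul_one]
  have haE : a • ((1 : G) : E) = ((1 : G) : E) := by
    change ((a * 1 : G) : E) = _
    rw [mul_one, eq_comm, QuotientGroup.eq]; simp
  obtain ⟨F, hF, hFt⟩ := h.exists_lift (Equiv.Perm (E → ℚ)) ρ
    ((ρ t).trans (Equiv.subRight (Pi.single (t • ((1 : G) : E)) 1)))
    (fun g k _ _ => Equiv.ext fun m => hρmul g k m) (by
      ext1 m
      simp only [Equiv.Perm.mul_apply, Equiv.trans_apply, Equiv.subRight_apply, hρmul, hρsub,
        hρsingle, inv_smul_smul, haE]
      simp only [← hρmul]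
      simp [hsingle t])
  have hlin (g : G) : ∀ m m', F g m - F g m' = ρ g (m - m') := by
    have hg : g ∈ Subgroup.closure (MulAction.stabilizer G u ∪ {t} : Set G) :=
      h.closure_eq_top ▸ trivial
    induction hg using Subgroup.closure_induction with
    | mem g hg =>
      intro m m'
      rcases hg with hg | rfl
      · rw [hF g hg]; rfl
      · rw [hFt]; simp [hρsub]
    | one => intro m m'; funext e; simp [hρ]
    | mul g k _ _ hg hk =>
      intro m m'
      rw [map_mul, Equiv.Perm.mul_apply, Equiv.Perm.mul_apply, hg, hk, hρmul]
    | inv g _ hg =>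
      intro m m'
      have := hg ((F g)⁻¹ m) ((F g)⁻¹ m')
      rw [← Equiv.Perm.mul_apply, ← Equiv.Perm.mul_apply, mul_inv_cancel] at this
      simp only [Equiv.Perm.one_apply] at this
      rw [map_inv, this, ← hρmul]
      funext e; simp [hρ]
  have hFt' : F t⁻¹ 0 = Pi.single ((1 : G) : E) 1 := by
    rw [map_inv, hFt, Equiv.Perm.inv_eq_iff_eq]
    simp [hρsingle, hsingle t]
  let D (v : V) : E → ℚ := if hv : ∃ g : G, g • u = v then F hv.choose 0 else 0
  have hD (g : G) : D (g • u) = F g 0 := by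
    have hv : ∃ k : G, k • u = g • u := ⟨g, rfl⟩
    have h1 : (g⁻¹ * hv.choose) • u = u := by rw [mul_smul, hv.choose_spec, inv_smul_smul]
    have h2 : F hv.choose = F g * ρ (g⁻¹ * hv.choose) := by
      rw [← hF _ h1, ← map_mul, mul_inv_cancel_left]
    simp only [D, dif_pos hv]
    rw [h2]; rfl
  refine ⟨D, fun e => ?_⟩
  induction e using QuotientGroup.induction_on with
  | H g =>
    rw [orbitMap_mk, orbitMap_mk, smul_smul, hD, hD, map_mul, Equiv.Perm.mul_apply, hlin, hFt',
      sub_zero, hρsingle]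
    exact (hsingle g).symm

end IsCyclicHNNAt

theorem List.count_map_prodMap_id {α E V : Type*} [DecidableEq α] [DecidableEq E] [DecidableEq V]
    {C : List (α × E)} (hC : C.Nodup) (f : E → V) (i : α) (x : V) :
    (C.map (Prod.map id f)).count (i, x) =
      (((C.toFinset.filter fun c => c.1 = i).image Prod.snd).filter fun e => f e = x).card := by
  rw [List.count, List.countP_map, List.countP_eq_length_filter,
    ← List.toFinset_card_of_nodup (hC.filter _),
    ← Finset.card_image_of_injective (Finset.filter _ _) (Prod.mk_right_injective i)]
  congr 1
  ext ⟨j, e⟩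
  simp only [List.mem_toFinset, List.mem_filter, Function.comp_apply, Prod.map_apply, id_eq,
    beq_iff_eq, Prod.mk.injEq, Finset.mem_image, Finset.mem_filter, Prod.exists, exists_eq_right]
  constructor
  · rintro ⟨h, rfl, rfl⟩
    exact ⟨e, ⟨h, rfl⟩, rfl, rfl⟩
  · rintro ⟨e, ⟨h, rfl⟩, rfl, rfl⟩
    exact ⟨h, rfl, rfl⟩

namespace FreeGroup

variable {V : Type} [MulAction (FreeGroup (Fin 2)) V] {u : V} {t a : FreeGroup (Fin 2)}

theorem exists_basis_of_exists_basis_smul (g : FreeGroup (Fin 2))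
    (h : ∃ x y : FreeGroup (Fin 2), Subgroup.closure {x, y} = ⊤ ∧
      MulAction.stabilizer (FreeGroup (Fin 2)) (g • u) ≤ Subgroup.closure {x * y * x⁻¹, y}) :
    ∃ x y : FreeGroup (Fin 2), Subgroup.closure {x, y} = ⊤ ∧
      MulAction.stabilizer (FreeGroup (Fin 2)) u ≤ Subgroup.closure {x * y * x⁻¹, y} := by
  obtain ⟨x, y, hxy, hu⟩ := h
  have hmap (p q : FreeGroup (Fin 2)) : (Subgroup.closure {p, q}).map
      (MulAut.conj g⁻¹).toMonoidHom = Subgroup.closure {g⁻¹ * p * g, g⁻¹ * q * g} := by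
    rw [MonoidHom.map_closure, Set.image_pair]; simp
  refine ⟨g⁻¹ * x * g, g⁻¹ * y * g, ?_, ?_⟩
  · rw [← hmap, hxy, Subgroup.map_top_of_surjective _ (MulAut.conj g⁻¹).surjective]
  · have e : g⁻¹ * x * g * (g⁻¹ * y * g) * (g⁻¹ * x * g)⁻¹ = g⁻¹ * (x * y * x⁻¹) * g := by group
    rw [e, ← hmap]
    intro k hk
    refine ⟨g * k * g⁻¹, hu ?_, by simp [mul_assoc]⟩
    have hk : k • u = u := hk
    simp [mul_smul, hk]

theorem exists_basis_of_count_eq_one {L : List (Fin 2 × Bool)} (h : IsCyclicHNNAt u t (mk L))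
    [DecidableEq V] {ε : Fin 2 × V} (h₁ : (crossings L u).count ε = 1)
    (h₂ : ε ∉ crossings L (t⁻¹ • u)) :
    ∃ x y : FreeGroup (Fin 2), Subgroup.closure {x, y} = ⊤ ∧
      MulAction.stabilizer (FreeGroup (Fin 2)) u ≤ Subgroup.closure {x * y * x⁻¹, y} := by
  obtain ⟨L₁, p, L₂, rfl, hp⟩ := exists_append_of_mem_crossings
    (List.count_pos_iff.1 (h₁ ▸ Nat.one_pos))
  have hLu := h.smul_eq
  have hL : mk (L₁ ++ p :: L₂) = mk L₁ * mk [p] * mk L₂ := by simp [mul_mk]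
  rw [crossings_append, crossings, List.count_append, hp, List.count_cons_self] at h₁
  have hL₁ : ε ∉ crossings L₁ (mk (p :: L₂) • u) := List.count_eq_zero.1 (by omega)
  have hL₂ : ε ∉ crossings L₂ u := List.count_eq_zero.1 (by omega)
  have hx : Avoids ε u (mk L₁)⁻¹ := by
    have := Avoids.inv ⟨L₁, rfl, hL₁⟩
    rwa [← mk_append_smul, hLu] at this
  have hw : Avoids ε (t⁻¹ • u) (mk L₁ * mk [p] * mk L₂) := ⟨_, hL, h₂⟩
  rw [hL] at h
  exact exists_basis_of_crosses_once h hp ⟨L₂, rfl, hL₂⟩ hx hw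

theorem exists_basis_of_isCyclicallyReduced {L : List (Fin 2 × Bool)}
    (hL : IsCyclicallyReduced L) (hne : L ≠ []) (h : IsCyclicHNNAt u t (mk L)) :
    ∃ x y : FreeGroup (Fin 2), Subgroup.closure {x, y} = ⊤ ∧
      MulAction.stabilizer (FreeGroup (Fin 2)) u ≤ Subgroup.closure {x * y * x⁻¹, y} := by
  classical
  obtain ⟨D, hD⟩ := h.exists_potential
  set ι := orbitMap (mk L) u h.smul_eq
  set τ := orbitMap (mk L) (t⁻¹ • u) h.smul_inv_smul_eq
  let e₀ : FreeGroup (Fin 2) ⧸ Subgroup.zpowers (mk L) := ((1 : FreeGroup (Fin 2)) : _)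
  have he₀ : ∀ g : FreeGroup (Fin 2), g • e₀ = e₀ → g ∈ Subgroup.zpowers (mk L) := by
    intro g hg
    have hg : ((g * 1 : FreeGroup (Fin 2)) : FreeGroup (Fin 2) ⧸ Subgroup.zpowers (mk L)) =
      ((1 : FreeGroup (Fin 2)) : _) := hg
    rw [mul_one, eq_comm, QuotientGroup.eq] at hg
    simpa using hg
  have hnodup := nodup_crossings hL he₀
  have hιu : (crossings L e₀).map (Prod.map id ι) = crossings L u := by
    rw [map_crossings ι (orbitMap_smul _)]
    congr 1
    exact one_smul _ u
  have hτu : (crossings L e₀).map (Prod.map id τ) = crossings L (t⁻¹ • u) := by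
    rw [map_crossings τ (orbitMap_smul _)]
    congr 1
    exact one_smul _ (t⁻¹ • u)
  obtain ⟨p, L', hpL⟩ := List.exists_cons_of_ne_nil hne
  have hmem : crossing p (mk L' • e₀) ∈ crossings L e₀ := by
    simp [hpL, crossings]
  have hS : (((crossings L e₀).toFinset.filter fun c => c.1 = p.1).image Prod.snd).Nonempty :=
    ⟨_, Finset.mem_image_of_mem _ (Finset.mem_filter.2
      ⟨List.mem_toFinset.2 (hmem : crossing p (mk L' • e₀) ∈ _), rfl⟩)⟩
  obtain ⟨x, hx⟩ := exists_leaf ι τ D hD hS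
  have hιx := List.count_map_prodMap_id hnodup ι p.1 x
  have hτx := List.count_map_prodMap_id hnodup τ p.1 x
  rw [hιu] at hιx
  rw [hτu] at hτx
  rw [← hιx, ← hτx] at hx
  rcases Nat.add_eq_one_iff.1 hx with ⟨h0, h1⟩ | ⟨h1, h0⟩
  · have h' := h.symm.conj t⁻¹
    have e₁ : t⁻¹ * t⁻¹ * t⁻¹⁻¹ = t⁻¹ := by group
    have e₂ : t⁻¹ * (t * mk L * t⁻¹) * t⁻¹⁻¹ = mk L := by group
    rw [e₁, e₂] at h'
    refine exists_basis_of_exists_basis_smul t⁻¹ (exists_basis_of_count_eq_one h' h1 ?_)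
    rw [smul_smul, inv_inv, mul_inv_cancel, one_smul]
    exact List.count_eq_zero.1 h0
  · exact exists_basis_of_count_eq_one h h1 (List.count_eq_zero.1 h0)

theorem exists_basis_stabilizer_le (h : IsCyclicHNNAt u t a) (ha : a ≠ 1) :
    ∃ x y : FreeGroup (Fin 2), Subgroup.closure {x, y} = ⊤ ∧
      MulAction.stabilizer (FreeGroup (Fin 2)) u ≤ Subgroup.closure {x * y * x⁻¹, y} := by
  set c := mk (reduceCyclically.conjugator a.toWord) with hc
  set L := reduceCyclically a.toWord with hL
  have hac : a = c * mk L * c⁻¹ := by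
    rw [hc, hL, inv_mk, mul_mk, mul_mk, reduceCyclically.conj_conjugator_reduceCyclically,
      mk_toWord]
  have h' := h.conj c⁻¹
  have e : c⁻¹ * a * c⁻¹⁻¹ = mk L := by rw [hac]; group
  rw [e] at h'
  refine exists_basis_of_exists_basis_smul c⁻¹ (exists_basis_of_isCyclicallyReduced
    (reduceCyclically.isCyclicallyReduced isReduced_toWord) (fun h0 => ha ?_) h')
  rw [hac, hL, h0, ← one_eq_mk]; group

end FreeGroup

theorem SplitsAsHNN.isCyclicHNNAt {G : Type} [Group G] {H : Subgroup G} {A B : Subgroup ↥H}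
    {ψ : A ≃* B} {t : G} (h : SplitsAsHNN H A B ψ t) {a₀ : ↥H} (hA : A = Subgroup.zpowers a₀) :
    IsCyclicHNNAt ((1 : G) : G ⧸ H) t a₀ := by
  obtain ⟨hcomp, hbij⟩ := h
  have hstab (g : G) : g • ((1 : G) : G ⧸ H) = ((1 : G) : G ⧸ H) ↔ g ∈ H := by
    rw [← MulAction.mem_stabilizer_iff, MulAction.stabilizer_quotient]
  let a : A := ⟨a₀, hA ▸ Subgroup.mem_zpowers a₀⟩
  have hta : t * a₀ * t⁻¹ = ((ψ a : ↥H) : G) := mul_inv_eq_iff_eq_mul.2 (hcomp a)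
  have hpow (b : A) : ∃ n : ℤ, b = a ^ n := by
    obtain ⟨n, hn⟩ := hA.le b.2
    exact ⟨n, Subtype.ext hn.symm⟩
  refine ⟨(hstab _).2 a₀.2, ?_, ?_, fun M _ f s hf hs => ?_⟩
  · rw [hstab, hta]; exact (ψ a : ↥H).2
  · rw [eq_top_iff]
    rintro g -
    obtain ⟨k, rfl⟩ := hbij.2 g
    induction k using HNNExtension.induction_on with
    | of h =>
      rw [HNNExtension.lift_of]
      exact Subgroup.subset_closure (.inl ((hstab _).2 h.2))
    | t => rw [HNNExtension.lift_t]; exact Subgroup.subset_closure (by simp)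
    | mul x y hx hy => rw [map_mul]; exact mul_mem hx hy
    | inv x hx => rw [map_inv]; exact inv_mem hx
  · let fH : ↥H →* M := MonoidHom.mk' (fun h => f h) fun h k =>
      hf h k ((hstab _).2 h.2) ((hstab _).2 k.2)
    have hfH : ∀ b : A, s * fH b = fH (ψ b) * s := by
      intro b
      obtain ⟨n, rfl⟩ := hpow b
      have hsa : SemiconjBy s (fH a) (fH (ψ a)) := by
        rw [hta] at hs; exact hs
      simpa [SemiconjBy] using (hsa.zpow_right n).eq
    let e := MulEquiv.ofBijective _ hbij
    refine ⟨(HNNExtension.lift fH s hfH).comp e.symm.toMonoidHom, fun g hg => ?_, ?_⟩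
    · have : e.symm g = HNNExtension.of ⟨g, (hstab g).1 hg⟩ := by
        rw [MulEquiv.symm_apply_eq]
        exact (HNNExtension.lift_of H.subtype t hcomp ⟨g, (hstab g).1 hg⟩).symm
      rw [MonoidHom.comp_apply, MulEquiv.coe_toMonoidHom, this, HNNExtension.lift_of]
      rfl
    · have : e.symm t = HNNExtension.t := by
        rw [MulEquiv.symm_apply_eq]
        exact (HNNExtension.lift_t H.subtype t hcomp).symm
      rw [MonoidHom.comp_apply, MulEquiv.coe_toMonoidHom, this, HNNExtension.lift_t]

/-- If `w ∈ F₂` is non-trivial and not contained in any subgroup `⟨xyx⁻¹, y⟩` for a basis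
`(x, y)` of `F₂`, then `F₂` has no cyclic splitting as an HNN extension relative to `w`. -/
theorem no_relative_cyclic_hnn_splitting (w : FreeGroup (Fin 2)) (hw : w ≠ 1)
    (hsub : ∀ x y : FreeGroup (Fin 2), Subgroup.closure {x, y} = ⊤ →
      w ∉ Subgroup.closure {x * y * x⁻¹, y}) :
    ¬ ∃ (H : Subgroup (FreeGroup (Fin 2))) (A B : Subgroup ↥H) (ψ : A ≃* B)
        (t : FreeGroup (Fin 2)),
        (∃ a₀ : ↥H, a₀ ≠ 1 ∧ A = Subgroup.zpowers a₀) ∧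
        (∃ b₀ : ↥H, b₀ ≠ 1 ∧ B = Subgroup.zpowers b₀) ∧
        SplitsAsHNN H A B ψ t ∧
        (∃ g : FreeGroup (Fin 2), g * w * g⁻¹ ∈ H) := by
  rintro ⟨H, A, B, ψ, t, ⟨a₀, ha₀, hA⟩, -, hsplit, g, hg⟩
  have hgw : g • g⁻¹ • ((1 : FreeGroup (Fin 2)) : FreeGroup (Fin 2) ⧸ H) =
      ((1 : FreeGroup (Fin 2)) : FreeGroup (Fin 2) ⧸ H) := smul_inv_smul _ _
  have hbasis := FreeGroup.exists_basis_stabilizer_le (hsplit.isCyclicHNNAt hA)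
    (fun h => ha₀ (Subtype.ext h))
  rw [← hgw] at hbasis
  obtain ⟨x, y, hxy, hle⟩ := FreeGroup.exists_basis_of_exists_basis_smul g hbasis
  refine hsub x y hxy (hle ?_)
  rw [MulAction.mem_stabilizer_iff, eq_inv_smul_iff, smul_smul, smul_smul,
    ← MulAction.mem_stabilizer_iff, MulAction.stabilizer_quotient]
  exact hg
end
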